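/- Let p and q be odd prime numbers with q ≥ 2p + 3, and let G be a finite abelian group of order pq. Then every subset A of G \ {0} with |A| = cr(G) − 1 contains a complete subset, i.e., a nonempty subset A' ⊆ A with Σ(A') = ⟨A'⟩. -/

import Mathlib

open Finset

/-- The set of all nonempty subset sums of a finite set `A`. -/
def nss {G : Type*} [AddCommGroup G] [DecidableEq G] (A : Finset G) : Finset G :=
  (A.powerset.erase ∅).image fun B => B.sum id

/-- The critical number of a finite abelian group `G`. -/
noncomputable def cr (G : Type*) [AddCommGroup G] [Fintype G] [DecidableEq G] : ℕ :=
  sInf {ℓ : ℕ | 0 < ℓ ∧ ∀ A : Finset G, (0 : G) ∉ A → ℓ ≤ A.card → nss A = Finset.univ}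

open scoped Pointwise
set_option linter.unusedSectionVars false

theorem add_zero_pair {F : Type*} [CommRing F] [DecidableEq F] (S : Finset F) (z : F) :
    S + {0, z} = S ∪ S.image (· + z) := by
  ext t; simp [mem_add, eq_comm]; grind

theorem card_triple {F : Type*} [CommRing F] [DecidableEq F] {x y z : F} (hx : x ≠ 0) (hy : y ≠ 0) (hz : z ≠ 0)
  (hx' : 2 * x ≠ 0) (hy' : 2 * y ≠ 0) (hz' : 2 * z ≠ 0)
  (hxy : x ≠ y) (hxz : x ≠ z) (hyz : y ≠ z) (hxy' : x + y ≠ 0) (hxz' : x + z ≠ 0) (hyz' : y + z ≠ 0) :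
    7 ≤ #(({0,x}+{0,y}+{0,z}) : Finset F) := by
  simp only [add_zero_pair]
  generalize hT : ((_ : Finset F) ∪ image _ _) = T
  have e : ∀ t, t ∈ T ↔ t = 0 ∨ t = x ∨ t = y ∨ t = z ∨ t = x + y ∨ t = x + z ∨ t = y + z ∨ t = x + y + z := by
    intro t; rw [← hT]; simp; grind
  by_cases h1 : z = x + y
  · have : #({0,x,y,x+y,x+z,y+z,x+y+z} : Finset F) = 7 := by
      repeat rw [card_insert_of_notMem (by simp; grind)]
      simp
    rw [← this]; apply card_le_card; intro t; rw [e]; simp; grind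
  · by_cases h1' : x + y + z = 0
    · have : #({0,x,y,z,x+y,x+z,y+z} : Finset F) = 7 := by
        repeat rw [card_insert_of_notMem (by simp; grind)]
        simp
      rw [← this]; apply card_le_card; intro t; rw [e]; simp; grind
    · by_cases h2 : x = y + z
      · have : #({0,x,y,z,x+y,x+z,x+y+z} : Finset F) = 7 := by
          repeat rw [card_insert_of_notMem (by simp; grind)]
          simp
        rw [← this]; apply card_le_card; intro t; rw [e]; simp; grind
      · have : #({0,x,z,x+y,x+z,y+z,x+y+z} : Finset F) = 7 := by
          repeat rw [card_insert_of_notMem (by simp; grind)]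
          simp
        rw [← this]; apply card_le_card; intro t; rw [e]; simp; grind

set_option maxHeartbeats 1000000 in
theorem card_hexagon {F : Type*} [CommRing F] [DecidableEq F] (h2 : ∀ a : F, 2 * a = 0 → a = 0)
    (h3 : ∀ a : F, 3 * a = 0 → a = 0) {x y z : F} (hx : x ≠ 0) (hy : y ≠ 0) (hz : z ≠ 0)
    (hxy : x ≠ y) (hxz : x ≠ z) (hyz : y ≠ z) (hxy' : x + y ≠ 0) (hxz' : x + z ≠ 0) (hyz' : y + z ≠ 0)
    (h1 : x + y ≠ z) (h1' : x + y + z ≠ 0) (h4 : 2 * x + y ≠ 0) (h5 : x + 2 * y ≠ 0) :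
    11 ≤ #(({0,x}+{0,y}+{0,z}+{0,x+y}) : Finset F) := by
  have hx2 : 2 * x ≠ 0 := fun h => hx (h2 _ h)
  have hy2 : 2 * y ≠ 0 := fun h => hy (h2 _ h)
  have hz2 : 2 * z ≠ 0 := fun h => hz (h2 _ h)
  have hw2 : 2 * (x + y) ≠ 0 := fun h => hxy' (h2 _ h)
  have hw3 : 3 * (x + y) ≠ 0 := fun h => hxy' (h3 _ h)
  have hx3 : 3 * x ≠ 0 := fun h => hx (h3 _ h)
  have hy3 : 3 * y ≠ 0 := fun h => hy (h3 _ h)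
  have h42 : 2 * (2 * x + y) ≠ 0 := fun h => h4 (h2 _ h)
  have h52 : 2 * (x + 2 * y) ≠ 0 := fun h => h5 (h2 _ h)
  have hxy2 : 2 * (x - y) ≠ 0 := fun h => hxy (sub_eq_zero.1 (h2 _ h))
  let h : Fin 6 → F := ![x, x + y, y, -x, -(x + y), -y]
  have hinj : ∀ i j, h i = h j → i = j := by
    intro i j hij
    fin_cases i <;> fin_cases j <;> simp [h] at hij ⊢ <;> grind
  have hE : ∀ i j, z = h i + h (i + 1) → z = h j + h (j + 1) → i = j := by
    intro i j hi hj
    fin_cases i <;> fin_cases j <;> simp [h] at hi hj ⊢ <;> grind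
  have hD : ∀ i j, z = 2 * h i → z = 2 * h j → i = j := by
    intro i j hi hj
    exact hinj _ _ (sub_eq_zero.1 (h2 _ (by linear_combination hj - hi)))
  have hdiff : ∀ i j, h i + z = h j → z = 2 * h (i + 3) ∨ z = h (i + 2) + h (i + 2 + 1) ∨
      z = h (i + 3) + h (i + 3 + 1) := by
    intro i j hij
    fin_cases i <;> fin_cases j <;> simp [h] at hij ⊢ <;> grind
  let T : Finset F := insert (x + y) (univ.image fun i => x + y + h i)
  have hT : #T = 7 := by
    rw [card_insert_of_notMem, card_image_of_injective _ (fun i j e => hinj i j (add_left_cancel e))]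
    · simp
    · simp only [mem_image, mem_univ, true_and, not_exists]
      intro i hi
      fin_cases i <;> simp [h] at hi <;> grind
  have hbad : #(T.filter fun t => t + z ∈ T) ≤ 3 := by
    have hsub : (T.filter fun t => t + z ∈ T) ⊆
        (univ.filter fun i : Fin 6 => z = 2 * h (i + 3)).image (fun i => x + y + h i) ∪
        ((univ.filter fun i : Fin 6 => z = h (i + 2) + h (i + 2 + 1)).image (fun i => x + y + h i) ∪
        (univ.filter fun i : Fin 6 => z = h (i + 3) + h (i + 3 + 1)).image (fun i => x + y + h i)) := by
      intro t ht
      rw [mem_filter] at ht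
      obtain ⟨h6, h7⟩ := ht
      simp only [T, mem_insert, mem_image, mem_univ, true_and] at h6 h7
      simp only [mem_union, mem_image, mem_filter, mem_univ, true_and]
      rcases h6 with rfl | ⟨i, rfl⟩
      · exfalso
        rcases h7 with h7 | ⟨j, h7⟩
        · grind
        · fin_cases j <;> simp [h] at h7 <;> grind
      · rw [← exists_or, ← exists_or]
        refine ⟨i, ?_⟩
        simp only [and_true]
        rcases h7 with h7 | ⟨j, h7⟩
        · exfalso
          replace h7 : h i + z = 0 := by linear_combination h7
          fin_cases i <;> simp [h] at h7 <;> grind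
        · exact hdiff i j (by linear_combination -h7)
    refine (card_le_card hsub).trans ((card_union_le _ _).trans ?_)
    refine (add_le_add le_rfl (card_union_le _ _)).trans ?_
    have k1 : ∀ f : Fin 6 → Prop, ∀ [DecidablePred f], (∀ i j, f i → f j → i = j) →
        #((univ.filter f).image (fun i => x + y + h i)) ≤ 1 := by
      intro f _ hf
      refine card_image_le.trans (card_le_one.2 ?_)
      simpa using fun i hi j hj => hf i j hi hj
    have a1 := k1 (fun i : Fin 6 => z = 2 * h (i + 3)) fun i j hi hj => add_right_cancel (hD _ _ hi hj)
    have a2 := k1 (fun i : Fin 6 => z = h (i + 2) + h (i + 2 + 1)) fun i j hi hj => add_right_cancel (hE _ _ hi hj)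
    have a3 := k1 (fun i : Fin 6 => z = h (i + 3) + h (i + 3 + 1)) fun i j hi hj => add_right_cancel (hE _ _ hi hj)
    omega
  have hU : #(T ∪ T.image (· + z)) ≥ 11 := by
    have e1 : T ∪ T.image (· + z) = T ∪ (T.filter fun t => ¬ (t + z ∈ T)).image (· + z) := by
      ext t; simp only [mem_union, mem_image, mem_filter]; grind
    have e2 := card_filter_add_card_filter_not (s := T) (fun t => t + z ∈ T)
    rw [e1, card_union_of_disjoint, card_image_of_injective _ (add_left_injective z)]
    · omega
    · rw [disjoint_right]; simp only [mem_image, mem_filter]; grind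
  refine hU.trans (card_le_card ?_)
  have : T = {x + y, 2 * x + y, 2 * x + 2 * y, x + 2 * y, y, 0, x} := by
    have : (univ : Finset (Fin 6)) = {0,1,2,3,4,5} := by decide
    simp only [T, this, image_insert, image_singleton]
    simp [h]
    ring_nf
  rw [this, add_right_comm, add_zero_pair]
  apply union_subset_union _ (image_subset_image _) <;>
  · simp only [add_zero_pair]
    intro t; simp; grind

theorem card_add_zero_neg {F : Type*} [CommRing F] [DecidableEq F] (S : Finset F) (a : F) :
    #(S + {0, -a}) = #(S + {0, a}) := by
  have : ({0, -a} : Finset F) = {0, a} + {-a} := by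
    simp only [insert_eq, union_add, singleton_add_singleton]; ext; simp; tauto
  rw [this, ← add_assoc, card_add_singleton]

theorem card_quad_of_rel {F : Type*} [CommRing F] [DecidableEq F] (h2 : ∀ a : F, 2 * a = 0 → a = 0)
    (h3 : ∀ a : F, 3 * a = 0 → a = 0) {x y z w : F} (hx : x ≠ 0) (hy : y ≠ 0) (hz : z ≠ 0) (hw : w ≠ 0)
    (hxy : x ≠ y) (hxz : x ≠ z) (hyz : y ≠ z) (hxy' : x + y ≠ 0) (hxz' : x + z ≠ 0) (hyz' : y + z ≠ 0)
    (hxw : x ≠ w) (hyw : y ≠ w) (hzw : z ≠ w) (hxw' : x + w ≠ 0) (hyw' : y + w ≠ 0) (hzw' : z + w ≠ 0)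
    (h : x + y = w ∨ x + y = - w ∨ x - y = w ∨ x - y = - w) :
    11 ≤ #(({0,x}+{0,y}+{0,z}+{0,w}) : Finset F) := by
  rcases h with h | h | h | h
  · rw [← h]
    apply card_hexagon h2 h3 <;> grind
  · rw [show w = -(x + y) by rw [h, neg_neg], card_add_zero_neg]
    apply card_hexagon h2 h3 <;> grind
  · have : #(({0,x}+{0,y}+{0,z}+{0,w}) : Finset F) = #(({0,x}+{0,-y}+{0,z}+{0,x + -y}) : Finset F) := by
      rw [← sub_eq_add_neg, h, add_right_comm {0, x}, add_right_comm _ _ {0, w}, ← card_add_zero_neg]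
      congr 1; ac_rfl
    rw [this]
    apply card_hexagon h2 h3 <;> grind
  · have : #(({0,x}+{0,y}+{0,z}+{0,w}) : Finset F) = #(({0,-x}+{0,y}+{0,z}+{0,-x + y}) : Finset F) := by
      rw [show -x + y = w by linear_combination -h, add_comm {0, x}, add_comm {0, -x},
        add_right_comm {0, y}, add_right_comm _ _ {0, w}, ← card_add_zero_neg]
      congr 1; ac_rfl
    rw [this]
    apply card_hexagon h2 h3 <;> grind

set_option maxHeartbeats 1000000 in
theorem card_quad {F : Type*} [CommRing F] [DecidableEq F] (h2 : ∀ a : F, 2 * a = 0 → a = 0)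
    (h3 : ∀ a : F, 3 * a = 0 → a = 0) {x y z w : F} (hx : x ≠ 0) (hy : y ≠ 0) (hz : z ≠ 0) (hw : w ≠ 0)
    (hxy : x ≠ y) (hxz : x ≠ z) (hyz : y ≠ z) (hxy' : x + y ≠ 0) (hxz' : x + z ≠ 0) (hyz' : y + z ≠ 0)
    (hxw : x ≠ w) (hyw : y ≠ w) (hzw : z ≠ w) (hxw' : x + w ≠ 0) (hyw' : y + w ≠ 0) (hzw' : z + w ≠ 0) :
    11 ≤ #(({0,x}+{0,y}+{0,z}+{0,w}) : Finset F) := by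
  have hx2 : 2 * x ≠ 0 := fun h => hx (h2 _ h)
  have hy2 : 2 * y ≠ 0 := fun h => hy (h2 _ h)
  have hz2 : 2 * z ≠ 0 := fun h => hz (h2 _ h)
  have hw2 : 2 * w ≠ 0 := fun h => hw (h2 _ h)
  by_cases r1 : x + y = w ∨ x + y = - w ∨ x - y = w ∨ x - y = - w
  · apply card_quad_of_rel h2 h3 <;> assumption
  by_cases r2 : x + z = w ∨ x + z = - w ∨ x - z = w ∨ x - z = - w
  · rw [add_right_comm {0, x}]
    apply card_quad_of_rel h2 h3 <;> grind
  by_cases r3 : y + z = w ∨ y + z = - w ∨ y - z = w ∨ y - z = - w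
  · rw [add_comm {0, x}, add_right_comm {0, y}]
    apply card_quad_of_rel h2 h3 <;> grind
  by_cases r4 : x + y = z ∨ x + y = - z ∨ x - y = z ∨ x - y = - z
  · rw [add_right_comm _ {0, z}]
    apply card_quad_of_rel h2 h3 <;> grind
  simp only [not_or] at r1 r2 r3 r4
  obtain ⟨r1, r1', r1'', r1'''⟩ := r1
  obtain ⟨r2, r2', r2'', r2'''⟩ := r2
  obtain ⟨r3, r3', r3'', r3'''⟩ := r3
  obtain ⟨r4, r4', r4'', r4'''⟩ := r4
  have hxy2 : 2 * (x - y) ≠ 0 := fun h => hxy (sub_eq_zero.1 (h2 _ h))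
  have hxz2 : 2 * (x - z) ≠ 0 := fun h => hxz (sub_eq_zero.1 (h2 _ h))
  have hyz2 : 2 * (y - z) ≠ 0 := fun h => hyz (sub_eq_zero.1 (h2 _ h))
  have e3 : ∀ t, t = 0 ∨ t = x ∨ t = y ∨ t = z ∨ t = x + y ∨ t = x + z ∨ t = y + z ∨ t = x + y + z →
      t ∈ (({0,x}+{0,y}+{0,z}) : Finset F) := by
    intro t; simp only [add_zero_pair]; simp; grind
  rw [add_zero_pair _ w]
  generalize (({0,x}+{0,y}+{0,z}) : Finset F) = S at e3
  have e : ∀ t, t = 0 ∨ t = x ∨ t = y ∨ t = z ∨ t = x + y ∨ t = x + z ∨ t = y + z ∨ t = x + y + z ∨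
      t = w ∨ t = x + w ∨ t = y + w ∨ t = z + w → t ∈ S ∪ S.image (· + w) := by
    intro t ht
    simp only [mem_union, mem_image]
    rcases ht with h | h | h | h | h | h | h | h | h | h | h | h
    · exact Or.inl (e3 _ (by tauto))
    · exact Or.inl (e3 _ (by tauto))
    · exact Or.inl (e3 _ (by tauto))
    · exact Or.inl (e3 _ (by tauto))
    · exact Or.inl (e3 _ (by tauto))
    · exact Or.inl (e3 _ (by tauto))
    · exact Or.inl (e3 _ (by tauto))
    · exact Or.inl (e3 _ (by tauto))
    · exact Or.inr ⟨0, e3 _ (by tauto), by rw [h, zero_add]⟩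
    · exact Or.inr ⟨x, e3 _ (by tauto), h.symm⟩
    · exact Or.inr ⟨y, e3 _ (by tauto), h.symm⟩
    · exact Or.inr ⟨z, e3 _ (by tauto), h.symm⟩
  generalize S ∪ S.image (· + w) = T at e
  by_cases c1 : w = x + y + z ∨ w = y + z - x
  · have : #({x + w, z + w, 0, x, y, z, x + y, x + z, y + z, x + y + z, y + w} : Finset F) = 11 ∨
      #({w, z + w, 0, x, y, z, x + y, x + z, y + z, x + y + z, y + w} : Finset F) = 11 := by
      rcases c1 with c1 | c1
      · left
        repeat rw [card_insert_of_notMem (by simp; grind)]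
        simp
      · right
        repeat rw [card_insert_of_notMem (by simp; grind)]
        simp
    rcases this with this | this <;> rw [← this] <;> apply card_le_card <;> intro t <;>
      simp only [mem_insert, mem_singleton] <;> intro ht <;> apply e <;>
      rcases ht with h | h | h | h | h | h | h | h | h | h | h <;> simp only [h, true_or, or_true]
  · rw [not_or] at c1
    obtain ⟨c1, c2⟩ := c1
    have : #({w, x + w, 0, x, y, z, x + y, x + z, y + z, x + y + z, y + w} : Finset F) = 11 ∨
      #({w, x + w, 0, x, y, z, x + y, x + z, y + z, x + y + z, z + w} : Finset F) = 11 := by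
      by_cases c3 : w = x + z - y
      · right
        repeat rw [card_insert_of_notMem (by simp; grind)]
        simp
      · left
        repeat rw [card_insert_of_notMem (by simp; grind)]
        simp
    rcases this with this | this <;> rw [← this] <;> apply card_le_card <;> intro t <;>
      simp only [mem_insert, mem_singleton] <;> intro ht <;> apply e <;>
      rcases ht with h | h | h | h | h | h | h | h | h | h | h <;> simp only [h, true_or, or_true]

/-- All subset sums (the empty one included) of the family `f` over `R`. -/
def ssum {ι M : Type*} [AddCommMonoid M] [DecidableEq M] (f : ι → M) (R : Finset ι) : Finset M :=
  R.powerset.image fun B => ∑ i ∈ B, f i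

section
variable {ι M : Type*} [DecidableEq ι] [AddCommMonoid M] [DecidableEq M] {f : ι → M} {R S : Finset ι}

theorem mem_ssum {x : M} : x ∈ ssum f R ↔ ∃ B ⊆ R, ∑ i ∈ B, f i = x := by
  simp [ssum]

theorem zero_mem_ssum : 0 ∈ ssum f R := mem_ssum.2 ⟨∅, by simp⟩

theorem ssum_nonempty : (ssum f R).Nonempty := ⟨0, zero_mem_ssum⟩

theorem ssum_mono (h : R ⊆ S) : ssum f R ⊆ ssum f S := by
  intro x hx
  obtain ⟨B, hB, rfl⟩ := mem_ssum.1 hx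
  exact mem_ssum.2 ⟨B, hB.trans h, rfl⟩

theorem ssum_union (h : Disjoint R S) : ssum f (R ∪ S) = ssum f R + ssum f S := by
  ext x
  simp only [mem_add, mem_ssum]
  constructor
  · rintro ⟨B, hB, rfl⟩
    refine ⟨_, ⟨B ∩ R, inter_subset_right, rfl⟩, _, ⟨B ∩ S, inter_subset_right, rfl⟩, ?_⟩
    rw [← sum_union (h.mono inter_subset_right inter_subset_right), ← inter_union_distrib_left,
      inter_eq_left.2 hB]
  · rintro ⟨_, ⟨B, hB, rfl⟩, _, ⟨C, hC, rfl⟩, rfl⟩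
    exact ⟨B ∪ C, union_subset_union hB hC, sum_union (h.mono hB hC)⟩

theorem ssum_empty : ssum f ∅ = {0} := by simp [ssum]

theorem ssum_singleton (i : ι) : ssum f {i} = {0, f i} := by
  ext x; simp [mem_ssum, subset_singleton_iff, eq_comm]

theorem ssum_insert {i : ι} (h : i ∉ R) : ssum f (insert i R) = ssum f R + {0, f i} := by
  rw [insert_eq, union_comm, ssum_union (disjoint_singleton_right.2 h), ssum_singleton]

end

/-- The subset sums of `f` over `R` number at least `t + 1`, unless they cover at least `q` values. -/
def Gain {ι : Type*} {q : ℕ} (f : ι → ZMod q) (R : Finset ι) (t : ℕ) : Prop :=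
  min q (t + 1) ≤ #(ssum f R)

/-- The gain of `s` summands in pairwise distinct classes modulo sign, for `s ≤ 4`. -/
def classGain (s : ℕ) : ℕ := s * (s + 1) / 2

section
variable {ι : Type*} [DecidableEq ι] {q : ℕ} [hq : Fact q.Prime] {f : ι → ZMod q} {R S : Finset ι}

theorem Gain.mono {t u : ℕ} (h : Gain f R t) (hu : u ≤ t) : Gain f R u := by
  unfold Gain at *; omega

theorem Gain.subset {t : ℕ} (h : Gain f R t) (hR : R ⊆ S) : Gain f S t :=
  le_trans h (card_le_card (ssum_mono hR))

theorem Gain.union {t u : ℕ} (hR : Gain f R t) (hS : Gain f S u) (h : Disjoint R S) :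
    Gain f (R ∪ S) (t + u) := by
  unfold Gain at *
  rw [ssum_union h]
  have := ZMod.cauchy_davenport hq.out (ssum_nonempty (f := f) (R := R)) (ssum_nonempty (f := f) (R := S))
  omega

theorem Gain.ssum_eq_univ (h : Gain f R (q - 1)) : ssum f R = univ := by
  have := hq.out.pos
  rw [← card_eq_iff_eq_univ, ZMod.card]
  refine le_antisymm ((card_le_univ _).trans (ZMod.card q).le) ?_
  unfold Gain at h; omega

theorem gain_of_injOn (h11 : 11 ≤ q) {T : Finset ι} (h0 : ∀ i ∈ T, f i ≠ 0)
    (hT : Set.InjOn (fun i => f i ^ 2) T) (h4 : #T ≤ 4) : Gain f T (classGain #T) := by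
  have hn : ∀ n : ℕ, 0 < n → n < 11 → (n : ZMod q) ≠ 0 := by
    intro n h0 h11 h
    rw [ZMod.natCast_eq_zero_iff] at h
    have := Nat.le_of_dvd h0 h
    omega
  have h2 : ∀ a : ZMod q, 2 * a = 0 → a = 0 := fun a h =>
    (mul_eq_zero.1 h).resolve_left (by exact_mod_cast hn 2 (by omega) (by omega))
  have h3 : ∀ a : ZMod q, 3 * a = 0 → a = 0 := fun a h =>
    (mul_eq_zero.1 h).resolve_left (by exact_mod_cast hn 3 (by omega) (by omega))
  have key : ∀ i ∈ T, ∀ j ∈ T, i ≠ j → f i ≠ f j ∧ f i + f j ≠ 0 := by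
    intro i hi j hj hij
    refine ⟨fun h => hij (hT hi hj (by simp [h])), fun h => hij (hT hi hj ?_)⟩
    simp only
    linear_combination (f i - f j) * h
  have h2' : ∀ i ∈ T, 2 * f i ≠ 0 := fun i hi h => h0 i hi (h2 _ h)
  unfold Gain
  have hc : #T = 0 ∨ #T = 1 ∨ #T = 2 ∨ #T = 3 ∨ #T = 4 := by omega
  rcases hc with hc | hc | hc | hc | hc <;> rw [hc]
  · rw [card_eq_zero.1 hc, ssum_empty]; simp [classGain]
  · obtain ⟨a, rfl⟩ := card_eq_one.1 hc
    rw [ssum_singleton, card_pair (h0 a (by simp)).symm]; simp [classGain]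
  · obtain ⟨a, b, hab, rfl⟩ := card_eq_two.1 hc
    rw [ssum_insert (by simpa using hab), ssum_singleton]
    have := h0 a (by simp)
    have := h0 b (by simp)
    have := key a (by simp) b (by simp) hab
    rw [add_zero_pair]
    refine (min_le_right _ _).trans (le_of_eq ?_)
    have : ({0, f b} ∪ image (· + f a) {0, f b} : Finset (ZMod q)) = {0, f a, f b, f a + f b} := by
      ext t; simp; grind
    rw [this]
    repeat rw [card_insert_of_notMem (by simp; grind)]
    simp [classGain]
  · obtain ⟨a, b, c, hab, hac, hbc, rfl⟩ := card_eq_three.1 hc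
    rw [ssum_insert (by simp [hab, hac]), ssum_insert (by simp [hbc]), ssum_singleton]
    refine (min_le_right _ _).trans ?_
    have k1 := key a (by simp) b (by simp) hab
    have k2 := key a (by simp) c (by simp) hac
    have k3 := key b (by simp) c (by simp) hbc
    have := card_triple (h0 a (by simp)) (h0 b (by simp)) (h0 c (by simp)) (h2' a (by simp))
      (h2' b (by simp)) (h2' c (by simp)) k1.1 k2.1 k3.1 k1.2 k2.2 k3.2
    refine this.trans (le_of_eq (congrArg card ?_))
    abel
  · obtain ⟨a, T', haT, rfl, hc'⟩ := card_eq_succ.1 hc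
    obtain ⟨b, c, d, hbc, hbd, hcd, rfl⟩ := card_eq_three.1 hc'
    simp only [mem_insert, mem_singleton, not_or] at haT
    obtain ⟨hab, hac, had⟩ := haT
    rw [ssum_insert (by simp [hab, hac, had]), ssum_insert (by simp [hbc, hbd]),
      ssum_insert (by simp [hcd]), ssum_singleton]
    refine (min_le_right _ _).trans ?_
    have k1 := key a (by simp) b (by simp) hab
    have k2 := key a (by simp) c (by simp) hac
    have k3 := key a (by simp) d (by simp) had
    have k4 := key b (by simp) c (by simp) hbc
    have k5 := key b (by simp) d (by simp) hbd
    have k6 := key c (by simp) d (by simp) hcd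
    have := card_quad h2 h3 (h0 a (by simp)) (h0 b (by simp)) (h0 c (by simp)) (h0 d (by simp))
      k1.1 k2.1 k4.1 k1.2 k2.2 k4.2 k3.1 k5.1 k6.1 k3.2 k5.2 k6.2
    refine this.trans (le_of_eq (congrArg card ?_))
    abel

theorem exists_transversal {β : Type*} [DecidableEq β] (g : ι → β) {n s : ℕ}
    (hR : ∀ c, #(R.filter fun i => g i = c) ≤ n + 1)
    (hs : s * (n + 1) ≤ #R + n) (hs' : #R ≤ s * (n + 1) + n) :
    ∃ T ⊆ R, #T = s ∧ Set.InjOn g T ∧ ∀ c, #((R \ T).filter fun i => g i = c) ≤ n := by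
  classical
  let C := R.image g
  let F := C.filter fun c => #(R.filter fun i => g i = c) = n + 1
  have hcardR : #R = ∑ c ∈ C, #(R.filter fun i => g i = c) :=
    card_eq_sum_card_fiberwise fun i hi => mem_coe.2 (mem_image_of_mem g hi)
  have hF : #F * (n + 1) ≤ #R := by
    rw [hcardR]
    calc #F * (n + 1) = ∑ c ∈ F, #(R.filter fun i => g i = c) := by
          rw [sum_congr rfl (fun c hc => (mem_filter.1 hc).2), sum_const, smul_eq_mul]
      _ ≤ _ := sum_le_sum_of_subset (filter_subset _ _)
  have hC : #R ≤ #C * (n + 1) := by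
    rw [hcardR]
    exact sum_le_card_nsmul _ _ _ fun c _ => hR c
  have hFs : #F ≤ s := by
    by_contra h
    have : (s + 1) * (n + 1) ≤ #F * (n + 1) := Nat.mul_le_mul_right _ (by omega)
    rw [add_mul] at this
    omega
  have hsC : s ≤ #C := by
    by_contra h
    have : (#C + 1) * (n + 1) ≤ s * (n + 1) := Nat.mul_le_mul_right _ (by omega)
    rw [add_mul] at this
    omega
  obtain ⟨D, hFD, hDC, hD⟩ := exists_subsuperset_card_eq (filter_subset _ _ : F ⊆ C) hFs hsC
  obtain hι | hι := isEmpty_or_nonempty ι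
  · have hR0 : R = ∅ := Subsingleton.elim _ _
    have hs0 : s = 0 := by simpa [C, hR0] using hsC
    exact ⟨∅, by simp, by simp [hs0], by simp, fun c => by simp [hR0]⟩
  have hex : ∀ c ∈ D, ∃ i ∈ R, g i = c := fun c hc => mem_image.1 (hDC hc)
  choose! e he hge using hex
  refine ⟨D.image e, ?_, ?_, ?_, ?_⟩
  · intro i hi
    obtain ⟨c, hc, rfl⟩ := mem_image.1 hi
    exact he c hc
  · rw [card_image_of_injOn, hD]
    intro c hc d hd h
    rw [← hge c hc, ← hge d hd, h]
  · intro i hi j hj h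
    obtain ⟨c, hc, rfl⟩ := mem_image.1 (mem_coe.1 hi)
    obtain ⟨d, hd, rfl⟩ := mem_image.1 (mem_coe.1 hj)
    rw [hge c hc, hge d hd] at h
    rw [h]
  · intro c
    by_cases hcF : c ∈ F
    · have hcD := hFD hcF
      have : ((R \ D.image e).filter fun i => g i = c) ⊆ (R.filter fun i => g i = c).erase (e c) := by
        intro i hi
        simp only [mem_filter, mem_sdiff] at hi
        rw [mem_erase, mem_filter]
        exact ⟨fun h => hi.1.2 (h ▸ mem_image_of_mem e hcD), hi.1.1, hi.2⟩
      refine (card_le_card this).trans ?_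
      rw [card_erase_of_mem (mem_filter.2 ⟨he c hcD, hge c hcD⟩), (mem_filter.1 hcF).2]
      omega
    · have h1 : #((R \ D.image e).filter fun i => g i = c) ≤ #(R.filter fun i => g i = c) :=
        card_le_card (filter_subset_filter _ sdiff_subset)
      by_cases hcC : c ∈ C
      · have h2 : #(R.filter fun i => g i = c) ≠ n + 1 := fun h => hcF (mem_filter.2 ⟨hcC, h⟩)
        have := hR c
        omega
      · refine h1.trans ?_
        rw [filter_false_of_mem]
        · simp
        · exact fun i hi h => hcC (h ▸ mem_image_of_mem g hi)

theorem gain_of_class_le (h11 : 11 ≤ q) {α β : ℕ} (hαβ : ∀ s ≤ 4, α * s ≤ classGain s + β) (n : ℕ)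
    (h0 : ∀ i ∈ R, f i ≠ 0) (hR : ∀ c, #(R.filter fun i => f i ^ 2 = c) ≤ n) (h4 : #R ≤ 4 * n) :
    Gain f R (α * #R - β * n) := by
  induction n generalizing R with
  | zero =>
    have : R = ∅ := card_eq_zero.1 (by omega)
    subst this
    simp [Gain, ssum_empty]
  | succ n ih =>
    have hd := Nat.div_add_mod (#R + n) (n + 1)
    have hm := Nat.mod_lt (#R + n) (by omega : n + 1 > 0)
    generalize hs : (#R + n) / (n + 1) = s at hd
    have hs4 : s ≤ 4 := by
      by_contra h
      have : (n + 1) * 5 ≤ (n + 1) * s := Nat.mul_le_mul_left _ (by omega)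
      omega
    rw [mul_comm] at hd
    obtain ⟨T, hTR, hTs, hT, hT'⟩ := exists_transversal (fun i => f i ^ 2) (s := s) hR (by omega) (by omega)
    have hc : #(R \ T) = #R - s := by rw [card_sdiff_of_subset hTR, hTs]
    have h1 := gain_of_injOn h11 (fun i hi => h0 i (hTR hi)) hT (by omega)
    have h2 := ih (R := R \ T) (fun i hi => h0 i (mem_sdiff.1 hi).1) hT' (by
      rw [hc]
      by_contra h
      interval_cases s <;> omega)
    have h3 := h1.union h2 disjoint_sdiff
    rw [union_sdiff_of_subset hTR] at h3
    refine h3.mono ?_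
    rw [hc, hTs, Nat.mul_sub, mul_add]
    have := hαβ s hs4
    have : α * s ≤ α * #R := Nat.mul_le_mul_left _ (hTs ▸ card_le_card hTR)
    omega

/-- Numerical condition under which classes of size at most `n` among `r` summands produce gain `t`. -/
def CoverCond (t r n : ℕ) : Prop := r ≤ 4 * n ∧ (t + n ≤ 2 * r ∨ t + 3 * n ≤ 3 * r ∨ t + 6 * n ≤ 4 * r)

theorem gain_of_coverCond (h11 : 11 ≤ q) {n t : ℕ} (h0 : ∀ i ∈ R, f i ≠ 0)
    (hR : ∀ c, #(R.filter fun i => f i ^ 2 = c) ≤ n) (h : CoverCond t #R n) : Gain f R t := by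
  obtain ⟨h4, h | h | h⟩ := h
  · exact (gain_of_class_le h11 (α := 2) (β := 1) (by decide) n h0 hR h4).mono (by omega)
  · exact (gain_of_class_le h11 (α := 3) (β := 3) (by decide) n h0 hR h4).mono (by omega)
  · exact (gain_of_class_le h11 (α := 4) (β := 6) (by decide) n h0 hR h4).mono (by omega)

end

/-- Every element of the group is a nonempty subset sum of `A`. -/
def Reach {G : Type*} [AddCommMonoid G] (A : Finset G) : Prop :=
  ∀ g, ∃ B ⊆ A, B.Nonempty ∧ ∑ b ∈ B, b = g

section
variable {p q : ℕ} [hp : Fact p.Prime] [hq : Fact q.Prime] {A F R : Finset (ZMod p × ZMod q)}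

/-- Within some fiber of the second projection, at least `t + 1` elements (or the whole fiber) are
nonempty subset sums of `F`. -/
def KGain (F : Finset (ZMod p × ZMod q)) (t : ℕ) : Prop :=
  ∃ c, ∃ X : Finset (ZMod p), min p (t + 1) ≤ #X ∧
    ∀ x ∈ X, ∃ B ⊆ F, B.Nonempty ∧ ∑ b ∈ B, b = (x, c)

theorem kgain_of_fiber {c : ZMod q} (hF : F.Nonempty) (h : ∀ a ∈ F, a.2 = c) : KGain F (#F - 1) := by
  refine ⟨c, F.image Prod.fst, ?_, ?_⟩
  · have h0 := hF.card_pos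
    rw [card_image_of_injOn]
    · omega
    · intro a ha b hb hab
      exact Prod.ext hab ((h a ha).trans (h b hb).symm)
  · intro x hx
    obtain ⟨a, ha, rfl⟩ := mem_image.1 hx
    exact ⟨{a}, by simpa using ha, by simp, by simp [← h a ha]⟩

theorem KGain.union {t u : ℕ} (hF : KGain F t) (hR : KGain R u) (h : Disjoint F R) :
    KGain (F ∪ R) (t + u) := by
  obtain ⟨c, X, hX, hX'⟩ := hF
  obtain ⟨d, Y, hY, hY'⟩ := hR
  have := hp.out.pos
  have hX0 : X.Nonempty := card_pos.1 (by omega)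
  have hY0 : Y.Nonempty := card_pos.1 (by omega)
  refine ⟨c + d, X + Y, ?_, ?_⟩
  · have := ZMod.cauchy_davenport hp.out hX0 hY0
    omega
  · intro z hz
    obtain ⟨x, hx, y, hy, rfl⟩ := mem_add.1 hz
    obtain ⟨B, hB, hB0, hBs⟩ := hX' x hx
    obtain ⟨C, hC, hC0, hCs⟩ := hY' y hy
    exact ⟨B ∪ C, union_subset_union hB hC, hB0.mono subset_union_left,
      by rw [sum_union (h.mono hB hC), hBs, hCs]; rfl⟩

theorem KGain.insert {t : ℕ} (hF : KGain F t) {a : ZMod p × ZMod q} (ha : a ∉ F) (h1 : a.1 ≠ 0)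
    (h2 : a.2 = 0) : KGain (insert a F) (t + 1) := by
  obtain ⟨c, X, hX, hX'⟩ := hF
  have := hp.out.pos
  have hX0 : X.Nonempty := card_pos.1 (by omega)
  refine ⟨c, X + {0, a.1}, ?_, ?_⟩
  · have := ZMod.cauchy_davenport hp.out hX0 (t := {0, a.1}) (by simp)
    rw [card_pair h1.symm] at this
    omega
  · intro z hz
    obtain ⟨x, hx, y, hy, rfl⟩ := mem_add.1 hz
    obtain ⟨B, hB, hB0, hBs⟩ := hX' x hx
    rw [mem_insert, mem_singleton] at hy
    rcases hy with rfl | rfl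
    · exact ⟨B, hB.trans (subset_insert _ _), hB0, by simpa using hBs⟩
    · refine ⟨Insert.insert a B, insert_subset_insert _ hB, by simp, ?_⟩
      rw [sum_insert (fun h => ha (hB h)), hBs]
      ext <;> simp [add_comm, h2]

theorem KGain.union_kernel {t : ℕ} (hF : KGain F t) (h : Disjoint F R)
    (hR : ∀ a ∈ R, a.1 ≠ 0 ∧ a.2 = 0) : KGain (F ∪ R) (t + #R) := by
  induction R using Finset.induction_on with
  | empty => simpa using hF
  | insert a s ha ih =>
    rw [disjoint_insert_right] at h
    have := ih h.2 fun b hb => hR b (mem_insert_of_mem hb)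
    rw [union_insert, card_insert_of_notMem ha, ← add_assoc]
    exact this.insert (by simp [h.1, ha]) (hR a (mem_insert_self _ _)).1 (hR a (mem_insert_self _ _)).2

theorem kgain_of_nonempty (hF : F.Nonempty) : KGain F (#F - #(F.image Prod.snd)) := by
  induction F using Finset.strongInduction with
  | H F ih =>
    obtain ⟨a, ha⟩ := hF
    set U := F.filter fun x => x.2 = a.2 with hU
    have haU : a ∈ U := by simp [U, ha]
    have hUF : U ⊆ F := filter_subset _ _
    have hUg : KGain U (#U - 1) := kgain_of_fiber ⟨a, haU⟩ (c := a.2) (by simp [U])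
    have hU0 : 0 < #U := card_pos.2 ⟨a, haU⟩
    by_cases h : (F \ U).Nonempty
    · have hss : F \ U ⊂ F := sdiff_ssubset hUF ⟨a, haU⟩
      have h1 := (hUg.union (ih _ hss h) disjoint_sdiff)
      rw [union_sdiff_of_subset hUF] at h1
      have him : (F \ U).image Prod.snd = (F.image Prod.snd).erase a.2 := by
        ext c
        simp only [mem_image, mem_sdiff, mem_erase, U, mem_filter]
        grind
      rw [him, card_erase_of_mem (mem_image_of_mem _ ha), card_sdiff_of_subset hUF] at h1
      have h2 : #((F \ U).image Prod.snd) ≤ #(F \ U) := card_image_le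
      rw [him, card_erase_of_mem (mem_image_of_mem _ ha), card_sdiff_of_subset hUF] at h2
      have h3 : 0 < #(F.image Prod.snd) := card_pos.2 ⟨_, mem_image_of_mem _ ha⟩
      have h4 := card_le_card hUF
      convert h1 using 1
      omega
    · rw [not_nonempty_iff_eq_empty, sdiff_eq_empty_iff_subset] at h
      have hFU : F = U := subset_antisymm h hUF
      have : F.image Prod.snd = {a.2} := by
        rw [hFU]
        ext c
        simp only [mem_image, mem_singleton, U, mem_filter]
        grind
      rw [this, card_singleton, hFU]
      exact hUg

theorem KGain.reach {t : ℕ} (hF : KGain F t) (ht : p ≤ t + 1) (hR : Gain Prod.snd R (q - 1))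
    (h : Disjoint F R) (hFA : F ⊆ A) (hRA : R ⊆ A) : Reach A := by
  obtain ⟨c, X, hX, hX'⟩ := hF
  have hXu : X = univ := by
    rw [← card_eq_iff_eq_univ, ZMod.card]
    have := card_le_univ X
    rw [ZMod.card] at this
    omega
  intro g
  have h1 : g.2 - c ∈ ssum Prod.snd R := by rw [hR.ssum_eq_univ]; simp
  obtain ⟨C, hC, hCs⟩ := mem_ssum.1 h1
  obtain ⟨B, hB, hB0, hBs⟩ := hX' (g.1 - (∑ i ∈ C, i).1) (by simp [hXu])
  refine ⟨B ∪ C, union_subset (hB.trans hFA) (hC.trans hRA), hB0.mono subset_union_left, ?_⟩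
  rw [sum_union (h.mono hB hC), hBs]
  ext
  · simp
  · simp only [Prod.snd_add, Prod.snd_sum, hCs]; ring

/-- The number of elements of `A` with second coordinate `j`. -/
def fib (A : Finset (ZMod p × ZMod q)) (j : ZMod q) : ℕ := #(A.filter fun a => a.2 = j)

theorem sum_fib (A : Finset (ZMod p × ZMod q)) : ∑ j, fib A j = #A :=
  (card_eq_sum_card_fiberwise fun _ _ => mem_coe.2 (mem_univ _)).symm

theorem reach_of_fib (h11 : 11 ≤ q) (hA0 : 0 ∉ A) (u : ZMod q → ℕ) (hu : ∀ j, u j ≤ fib A j)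
    (hu0 : u 0 = 0) (hne : ∃ j, u j ≠ 0)
    (hk : p + #(univ.filter fun j => u j ≠ 0) ≤ ∑ j, u j + fib A 0 + 1) {n : ℕ}
    (hcl : ∀ x ≠ 0, (fib A x - u x) + (fib A (-x) - u (-x)) ≤ n)
    (hc : CoverCond (q - 1) (#A - fib A 0 - ∑ j, u j) n) : Reach A := by
  have hex : ∀ j, ∃ U ⊆ A.filter (fun a => a.2 = j), #U = u j := fun j =>
    exists_subset_card_eq (hu j)
  choose U hU hUc using hex
  let F := univ.biUnion U
  have hFA : F ⊆ A := by
    intro a ha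
    obtain ⟨j, -, hj⟩ := mem_biUnion.1 ha
    exact (mem_filter.1 (hU j hj)).1
  have hUsnd : ∀ j, ∀ a ∈ U j, a.2 = j := fun j a ha => (mem_filter.1 (hU j ha)).2
  have hFU : ∀ j, F.filter (fun a => a.2 = j) = U j := by
    intro j
    ext a
    simp only [F, mem_filter, mem_biUnion, mem_univ, true_and]
    constructor
    · rintro ⟨⟨i, hi⟩, rfl⟩
      rwa [hUsnd i a hi]
    · exact fun h => ⟨⟨j, h⟩, hUsnd j a h⟩
  have hFfib : ∀ j, fib F j = u j := fun j => by rw [fib, hFU, hUc]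
  have hFcard : #F = ∑ j, u j := by
    rw [← sum_fib]; exact sum_congr rfl fun j _ => hFfib j
  have him : F.image Prod.snd = univ.filter fun j => u j ≠ 0 := by
    ext j
    simp only [mem_image, mem_filter, mem_univ, true_and]
    rw [← hFfib, fib, ← Nat.pos_iff_ne_zero, card_pos, Finset.Nonempty]
    simp only [mem_filter]
  let Ker := A.filter fun a => a.2 = 0
  have hFne : F.Nonempty := by
    obtain ⟨j, hj⟩ := hne
    rw [← image_nonempty (f := Prod.snd), him]
    exact ⟨j, by simpa using hj⟩
  have hF0 : ∀ a ∈ F, a.2 ≠ 0 := by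
    intro a ha h
    have : a ∈ U 0 := by rw [← hFU]; exact mem_filter.2 ⟨ha, h⟩
    rw [card_eq_zero.1 ((hUc 0).trans hu0)] at this
    exact notMem_empty _ this
  have hdisj : Disjoint F Ker := by
    rw [disjoint_left]
    intro a ha h
    exact hF0 a ha (mem_filter.1 h).2
  have hK : KGain (F ∪ Ker) (#F - #(F.image Prod.snd) + #Ker) := by
    refine (kgain_of_nonempty hFne).union_kernel hdisj ?_
    intro a ha
    obtain ⟨h1, h2⟩ := mem_filter.1 ha
    exact ⟨fun h => hA0 (by rwa [show a = 0 from Prod.ext h h2] at h1), h2⟩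
  have hsub : F ∪ Ker ⊆ A := union_subset hFA (filter_subset _ _)
  refine hK.reach (R := A \ (F ∪ Ker)) ?_ ?_ disjoint_sdiff hsub sdiff_subset
  · have : #(F.image Prod.snd) ≤ #F := card_image_le
    rw [him, hFcard] at *
    change _ ≤ _ - _ + fib A 0 + 1
    omega
  · refine gain_of_coverCond h11 (n := n) ?_ ?_ ?_
    · intro a ha h
      rw [mem_sdiff, mem_union, not_or] at ha
      exact ha.2.2 (mem_filter.2 ⟨ha.1, h⟩)
    · intro c
      by_cases hcx : ∃ x : ZMod q, x ≠ 0 ∧ x ^ 2 = c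
      · obtain ⟨x, hx, rfl⟩ := hcx
        have hx' := hcl x hx
        have : (A \ (F ∪ Ker)).filter (fun i => i.2 ^ 2 = x ^ 2) ⊆
            ((A.filter fun a => a.2 = x) \ U x) ∪ ((A.filter fun a => a.2 = -x) \ U (-x)) := by
          intro a ha
          simp only [mem_filter, mem_sdiff, mem_union, not_or] at ha ⊢
          obtain ⟨⟨ha, haF, -⟩, h2⟩ := ha
          have hnot : ∀ j, a ∉ U j := fun j hj => haF (mem_biUnion.2 ⟨j, mem_univ _, hj⟩)
          rcases sq_eq_sq_iff_eq_or_eq_neg.1 h2 with h | h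
          · exact Or.inl ⟨⟨ha, h⟩, hnot _⟩
          · exact Or.inr ⟨⟨ha, h⟩, hnot _⟩
        refine (card_le_card this).trans ((card_union_le _ _).trans ?_)
        rw [card_sdiff_of_subset (hU _), card_sdiff_of_subset (hU _), hUc, hUc]
        exact hx'
      · rw [filter_false_of_mem, card_empty]
        · exact Nat.zero_le _
        · intro a ha h
          rw [mem_sdiff, mem_union, not_or] at ha
          exact hcx ⟨a.2, fun h0 => ha.2.2 (mem_filter.2 ⟨ha.1, h0⟩), h⟩
    · rw [card_sdiff_of_subset hsub, card_union_of_disjoint hdisj, hFcard]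
      convert hc using 1
      change _ - (_ + fib A 0) = _
      omega

end

section
variable {p q : ℕ} [hq : Fact q.Prime] {m : ZMod q → ℕ} {k : ℕ}

/-- The multiplicities `m` leave, after removing a part of gain at least `k`, enough summands to
cover `ZMod q`. -/
def Splits (m : ZMod q → ℕ) (k : ℕ) : Prop :=
  ∃ u : ZMod q → ℕ, (∀ j, u j ≤ m j) ∧ (∃ j, u j ≠ 0) ∧
    k + #(univ.filter fun j => u j ≠ 0) ≤ ∑ j, u j ∧
    ∃ n, (∀ x ≠ 0, (m x - u x) + (m (-x) - u (-x)) ≤ n) ∧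
      CoverCond (q - 1) (∑ j, m j - ∑ j, u j) n

theorem Splits.of_support (hm : ∑ j, m j = q - 2 + k) {W : Finset (ZMod q)} (hW : W.Nonempty)
    {u : ZMod q → ℕ} (hu : ∀ j, u j ≤ m j) (hs : ∀ j, u j ≠ 0 ↔ j ∈ W)
    (hsum : ∑ j ∈ W, u j = k + #W) {n : ℕ}
    (hn : ∀ x ≠ 0, (m x - u x) + (m (-x) - u (-x)) ≤ n) (hc : CoverCond (q - 1) (q - 2 - #W) n) :
    Splits m k := by
  have hsup : (univ.filter fun j => u j ≠ 0) = W := by ext j; simp [hs]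
  have hsum' : ∑ j, u j = k + #W := by
    rw [← hsum]
    refine (sum_subset (subset_univ W) fun j _ hj => ?_).symm
    by_contra h
    exact hj ((hs j).1 h)
  obtain ⟨x, hx⟩ := hW
  refine ⟨u, hu, ⟨x, (hs x).2 hx⟩, by rw [hsup, hsum'], n, hn, ?_⟩
  rw [hm, hsum']
  convert hc using 1
  omega

theorem neg_ne_self_of_ne_zero (h2 : 2 < q) {x : ZMod q} (hx : x ≠ 0) : -x ≠ x := by
  intro h
  have : (2 : ZMod q) * x = 0 := by rw [two_mul]; nth_rw 1 [← h]; ring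
  rcases mul_eq_zero.1 this with h | h
  · have := (ZMod.natCast_eq_zero_iff 2 q).1 (by exact_mod_cast h)
    exact absurd (Nat.le_of_dvd (by norm_num) this) (by omega)
  · exact hx h

theorem Splits.of_le_two (hq11 : 11 ≤ q) (hpq : 2 * p + 3 ≤ q) (hp : Odd p)
    (hk1 : 1 ≤ k) (hkp : k + 1 ≤ p) (hm : ∑ j, m j = q - 2 + k) (hm0 : m 0 = 0)
    (hz : ∃ j ≠ 0, m j = 0) (h2 : ∀ j, m j ≤ 2) : Splits m k := by
  set D := univ.filter fun j => m j = 2 with hD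
  have hDk : k ≤ #D := by
    obtain ⟨z, hz0, hz⟩ := hz
    have h1 : ∀ j, m j ≤ (if m j = 2 then 1 else 0) + (if j ≠ 0 ∧ j ≠ z then 1 else 0) := by
      intro j
      have := h2 j
      split_ifs with h h' h' <;> try omega
      · rw [not_and_or, not_not, not_not] at h'
        rcases h' with rfl | rfl <;> omega
      · rw [not_and_or, not_not, not_not] at h'
        rcases h' with rfl | rfl <;> omega
    have h3 := sum_le_sum fun j (_ : j ∈ univ) => h1 j
    rw [hm, sum_add_distrib, ← card_filter, ← card_filter, ← hD] at h3
    have h4 : #(univ.filter fun j : ZMod q => j ≠ 0 ∧ j ≠ z) = q - 2 := by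
      have : (univ.filter fun j : ZMod q => j ≠ 0 ∧ j ≠ z) = (univ.erase 0).erase z := by
        ext j; simp [and_comm]
      rw [this, card_erase_of_mem (by simp [hz0]), card_erase_of_mem (mem_univ _), card_univ,
        ZMod.card]
      omega
    omega
  set W0 := D.filter fun j => m (-j) = 2 ∧ j.val < (-j).val with hW0
  have hne : ∀ x : ZMod q, x ≠ 0 → -x ≠ x := fun x hx => neg_ne_self_of_ne_zero (by omega) hx
  have key : ∀ W ⊆ D, #W = k → ∀ n, (∀ x ≠ 0, (m x - if x ∈ W then 2 else 0) +
      (m (-x) - if -x ∈ W then 2 else 0) ≤ n) → CoverCond (q - 1) (q - 2 - k) n → Splits m k := by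
    intro W hWD hWk n hn hc
    refine Splits.of_support hm (W := W) (card_pos.1 (by omega))
      (u := fun j => if j ∈ W then 2 else 0) ?_ ?_ ?_ hn (hWk ▸ hc)
    · intro j
      split_ifs with h
      · exact (mem_filter.1 (hWD h)).2.ge
      · exact Nat.zero_le _
    · intro j
      split_ifs with h <;> simp [h]
    · rw [sum_congr rfl (g := fun _ => 2) fun j hj => if_pos hj]
      simp only [sum_const, smul_eq_mul]; omega
  rcases le_or_gt #W0 k with h | h
  · obtain ⟨W, hW0W, hWD, hWk⟩ := exists_subsuperset_card_eq (filter_subset _ D) h hDk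
    refine key W hWD hWk (max 3 ((q - 2 - k + 2) / 3)) ?_ ?_
    · intro x hx
      refine le_trans ?_ (le_max_left _ _)
      have hx1 := h2 x
      have hx2 := h2 (-x)
      by_contra! hcon
      have h3 : m x = 2 ∧ m (-x) = 2 ∧ x ∉ W ∧ -x ∉ W := by
        split_ifs at hcon <;> first | omega | (refine ⟨by omega, by omega, ?_, ?_⟩ <;> assumption)
      obtain ⟨h3, h4, h5, h6⟩ := h3
      rcases lt_trichotomy x.val (-x).val with h7 | h7 | h7
      · exact h5 (hW0W (mem_filter.2 ⟨by simp [hD, h3], h4, h7⟩))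
      · exact hne x hx (ZMod.val_injective q h7).symm
      · exact h6 (hW0W (mem_filter.2 ⟨by simp [hD, h4], by simpa using h3, by simpa using h7⟩))
    · unfold CoverCond
      obtain ⟨c, rfl⟩ := hp
      omega
  · obtain ⟨W, hWD, hWk⟩ := exists_subset_card_eq hDk
    have h4 : 4 * #W0 ≤ q - 2 + k := by
      have hdis : Disjoint W0 (W0.image Neg.neg) := by
        rw [disjoint_left]
        intro x hx hx'
        obtain ⟨y, hy, rfl⟩ := mem_image.1 hx'
        have h5 := (mem_filter.1 hx).2.2
        have h6 := (mem_filter.1 hy).2.2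
        rw [neg_neg] at h5
        omega
      rw [← hm]
      calc 4 * #W0 = ∑ j ∈ W0 ∪ W0.image Neg.neg, 2 := by
            rw [sum_const, card_union_of_disjoint hdis, card_image_of_injective _ neg_injective,
              smul_eq_mul]
            ring
        _ = ∑ j ∈ W0 ∪ W0.image Neg.neg, m j := by
            refine sum_congr rfl fun j hj => ?_
            rcases mem_union.1 hj with hj | hj
            · exact (mem_filter.1 (mem_filter.1 hj).1).2.symm
            · obtain ⟨y, hy, rfl⟩ := mem_image.1 hj
              exact (mem_filter.1 hy).2.1.symm
        _ ≤ ∑ j, m j := sum_le_sum_of_subset (subset_univ _)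
    refine key W hWD hWk (max 4 ((q - 2 - k + 2) / 3)) ?_ ?_
    · intro x hx
      refine le_trans ?_ (le_max_left _ _)
      have hx1 := h2 x
      have hx2 := h2 (-x)
      omega
    · unfold CoverCond
      omega
end

section
variable {p q : ℕ} [hq : Fact q.Prime] {m : ZMod q → ℕ} {k : ℕ}

/-- A cheapest family of fibers with gain at least `k`. -/
theorem exists_cheapest (h : k ≤ ∑ j, (m j - 1)) (hk : 1 ≤ k) :
    ∃ W : Finset (ZMod q), ∃ x ∈ W, (∀ y ∈ W, m x ≤ m y) ∧ (∀ y ∉ W, m y ≤ m x) ∧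
      ∑ y ∈ W.erase x, (m y - 1) < k ∧ k ≤ ∑ y ∈ W.erase x, (m y - 1) + (m x - 1) := by
  let P : Finset (Finset (ZMod q)) := univ.filter fun W => k ≤ ∑ j ∈ W, (m j - 1)
  have hP : P.Nonempty := ⟨univ, by simpa [P] using h⟩
  obtain ⟨W1, hW1, hmin⟩ := P.exists_min_image card hP
  obtain ⟨W, hW, hmax⟩ := (P.filter fun W => #W = #W1).exists_max_image
    (fun W => ∑ j ∈ W, (m j - 1)) ⟨W1, by simp [hW1]⟩
  simp only [mem_filter, P, mem_univ, true_and] at hW hmin hmax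
  have hW0 : W.Nonempty := by
    rw [nonempty_iff_ne_empty]; rintro rfl; simp at hW; omega
  obtain ⟨x, hx, hxm⟩ := W.exists_min_image m hW0
  have hx1 := sum_erase_add W (fun j => m j - 1) hx
  have hlt : ∑ y ∈ W.erase x, (m y - 1) < k := by
    by_contra! hcon
    have := hmin _ hcon
    rw [card_erase_of_mem hx] at this
    have := card_pos.2 hW0
    omega
  refine ⟨W, x, hx, hxm, ?_, hlt, by omega⟩
  intro y hy
  by_contra! hcon
  have hyn : y ∉ W.erase x := fun h => hy (mem_of_mem_erase h)
  have h2 : ∑ j ∈ insert y (W.erase x), (m j - 1) = (m y - 1) + ∑ j ∈ W.erase x, (m j - 1) :=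
    sum_insert hyn
  have h3 := hmax (insert y (W.erase x)) ⟨by omega, by
    rw [card_insert_of_notMem hyn, card_erase_of_mem hx, ← hW.2]
    have := card_pos.2 hW0
    omega⟩
  omega

theorem Splits.of_single (hm : ∑ j, m j = q - 2 + k) {x : ZMod q} (hx : k + 1 ≤ m x) {n : ℕ}
    (h1 : m x - (k + 1) + m (-x) ≤ n) (hn : ∀ y ≠ 0, y ≠ x → y ≠ -x → m y + m (-y) ≤ n)
    (hc : CoverCond (q - 1) (q - 3) n) : Splits m k := by
  refine Splits.of_support hm (W := {x}) (by simp) (u := fun j => if j = x then k + 1 else 0)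
    ?_ ?_ ?_ (n := n) ?_ hc
  · intro j
    split_ifs with h
    · rwa [h]
    · exact Nat.zero_le _
  · intro j
    simp
  · simp
  · intro y hy
    by_cases hyx : y = x
    · subst hyx
      rw [if_pos rfl]
      exact le_trans (by omega) h1
    by_cases hyx' : y = -x
    · subst hyx'
      rw [neg_neg, if_pos rfl]
      exact le_trans (by omega) h1
    · exact le_trans (by omega) (hn y hy hyx hyx')

theorem add_neg_add_le {x y : ZMod q} (h2 : 2 < q) (hx : x ≠ 0) (hy : y ≠ 0) (h : y ≠ x)
    (h' : y ≠ -x) : m x + m (-x) + (m y + m (-y)) ≤ ∑ j, m j := by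
  have hxn := neg_ne_self_of_ne_zero h2 hx
  have hyn := neg_ne_self_of_ne_zero h2 hy
  have : ∑ j ∈ ({x, -x, y, -y} : Finset (ZMod q)), m j = m x + m (-x) + (m y + m (-y)) := by
    rw [sum_insert, sum_insert, sum_insert, sum_singleton]
    · ring
    · simpa using hyn.symm
    · simp only [mem_insert, mem_singleton, not_or, neg_inj]
      exact ⟨h'.symm, h.symm⟩
    · simp only [mem_insert, mem_singleton, not_or]
      refine ⟨hxn.symm, h.symm, fun hh => h' ?_⟩
      rw [hh, neg_neg]
  rw [← this]
  exact sum_le_sum_of_subset (subset_univ _)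

theorem Splits.of_single_max (hq11 : 11 ≤ q) (hpq : 2 * p + 3 ≤ q) (hqo : Odd q)
    (hk1 : 1 ≤ k) (hkp : k + 1 ≤ p) (hm : ∑ j, m j = q - 2 + k) (hm0 : m 0 = 0)
    (hmp : ∀ j, m j ≤ p) {x : ZMod q} (hx : k + 1 ≤ m x) (hmax : ∀ y, m y ≤ m x) :
    Splits m k := by
  have hc : CoverCond (q - 1) (q - 3) (q - 5) := by unfold CoverCond; omega
  have hx0 : x ≠ 0 := by rintro rfl; omega
  by_cases h : ∀ y ≠ 0, y ≠ x → y ≠ -x → m y + m (-y) ≤ q - 5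
  · refine Splits.of_single hm hx ?_ h hc
    have := hmp x
    have := hmp (-x)
    omega
  · push Not at h
    obtain ⟨y, hy0, hyx, hyx', hy⟩ := h
    have key : ∀ y, y ≠ 0 → y ≠ x → y ≠ -x → m (-y) ≤ m y → q - 5 < m y + m (-y) →
        Splits m k := by
      intro y hy0 hyx hyx' hle hy
      have := hmp y
      obtain ⟨c, rfl⟩ := hqo
      have h5 := hmax y
      have h6 := hmp x
      refine Splits.of_single hm (x := y) (by omega) ?_ ?_ hc
      · omega
      · intro z hz0 hzy hzy'
        have := add_neg_add_le (m := m) (by omega) hy0 hz0 hzy hzy'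
        omega
    rcases le_total (m (-y)) (m y) with h | h
    · exact key y hy0 hyx hyx' h hy
    · refine key (-y) (neg_ne_zero.2 hy0) ?_ ?_ ?_ ?_
      · intro hh; exact hyx' (by rw [← hh, neg_neg])
      · simpa using hyx
      · simpa using h
      · rw [neg_neg]; omega

theorem Splits.of_cheapest (hm : ∑ j, m j = q - 2 + k) {W : Finset (ZMod q)} {x : ZMod q}
    (hxW : x ∈ W) (hW : ∀ y ∈ W, m x ≤ m y) (hlt : ∑ y ∈ W.erase x, (m y - 1) < k)
    (hle : k ≤ ∑ y ∈ W.erase x, (m y - 1) + (m x - 1)) {n : ℕ}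
    (hn : ∀ u : ZMod q → ℕ, (∀ y ∈ W.erase x, u y = m y) → (∀ y ∉ W, u y = 0) →
      u x = k - ∑ y ∈ W.erase x, (m y - 1) + 1 →
      ∀ x ≠ 0, (m x - u x) + (m (-x) - u (-x)) ≤ n)
    (hc : CoverCond (q - 1) (q - 2 - #W) n) : Splits m k := by
  set s := ∑ y ∈ W.erase x, (m y - 1) with hs
  let u : ZMod q → ℕ := fun y => if y = x then k - s + 1 else if y ∈ W then m y else 0
  have hux : u x = k - s + 1 := if_pos rfl
  have huW : ∀ y ∈ W.erase x, u y = m y := by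
    intro y hy
    rw [mem_erase] at hy
    simp [u, hy.1, hy.2]
  have huo : ∀ y ∉ W, u y = 0 := by
    intro y hy
    have : y ≠ x := by rintro rfl; exact hy hxW
    simp [u, this, hy]
  refine Splits.of_support hm (W := W) ⟨x, hxW⟩ (u := u) ?_ ?_ ?_ (n := n) (hn u huW huo hux) hc
  · intro j
    by_cases hj : j = x
    · subst hj; omega
    by_cases hjW : j ∈ W
    · exact (huW j (mem_erase.2 ⟨hj, hjW⟩)).le
    · simp [huo j hjW]
  · intro j
    by_cases hj : j = x
    · subst hj; simp [hux, hxW]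
    by_cases hjW : j ∈ W
    · rw [huW j (mem_erase.2 ⟨hj, hjW⟩)]
      have := hW j hjW
      refine ⟨fun _ => hjW, fun _ => by omega⟩
    · simp [huo j hjW, hjW]
  · rw [← sum_erase_add W u hxW, hux, sum_congr rfl huW]
    have : ∑ y ∈ W.erase x, m y = s + #(W.erase x) := by
      rw [hs, card_eq_sum_ones, ← sum_add_distrib]
      refine sum_congr rfl fun y hy => ?_
      have := hW y (mem_of_mem_erase hy)
      omega
    rw [this, card_erase_of_mem hxW]
    have := card_pos.2 ⟨x, hxW⟩
    omega

end

section
variable {p q : ℕ} [hq : Fact q.Prime] {m : ZMod q → ℕ} {k : ℕ}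

theorem coverCond_of_mul_le {a f : ℕ} (hq11 : 11 ≤ q) (hpq : 2 * p + 3 ≤ q) (ha : 3 ≤ a) (hf : 3 ≤ f)
    (h : (f - 1) * (a - 1) ≤ p - 2) :
    2 * a ≤ q - 3 - 2 * f ∧ CoverCond (q - 1) (q - 2 - f) (q - 3 - 2 * f) := by
  obtain ⟨a, rfl⟩ := Nat.exists_eq_add_of_le ha
  obtain ⟨f, rfl⟩ := Nat.exists_eq_add_of_le hf
  have h1 : (3 + f - 1) * (3 + a - 1) = 4 + 2 * f + 2 * a + f * a := by
    rw [show 3 + f - 1 = 2 + f by omega, show 3 + a - 1 = 2 + a by omega]; ring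
  rw [h1] at h
  have := Nat.zero_le (f * a)
  unfold CoverCond
  omega

theorem Splits.of_exists_zero (hq11 : 11 ≤ q) (hpq : 2 * p + 3 ≤ q) (hqo : Odd q) (hp : Odd p)
    (hk1 : 1 ≤ k) (hkp : k + 1 ≤ p) (hm : ∑ j, m j = q - 2 + k) (hm0 : m 0 = 0)
    (hmp : ∀ j, m j ≤ p) (hz : ∃ j ≠ 0, m j = 0) : Splits m k := by
  by_cases h2 : ∀ j, m j ≤ 2
  · exact Splits.of_le_two hq11 hpq hp hk1 hkp hm hm0 hz h2
  push Not at h2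
  obtain ⟨z, hz3⟩ := h2
  have hk : k ≤ ∑ j, (m j - 1) := by
    obtain ⟨w, hw0, hw⟩ := hz
    have h1 : ∑ j, m j ≤ ∑ j, (m j - 1) + ∑ j, (if j ≠ 0 ∧ j ≠ w then 1 else 0) := by
      rw [← sum_add_distrib]
      refine sum_le_sum fun j _ => ?_
      split_ifs with h'
      · omega
      · rw [not_and_or, not_not, not_not] at h'
        rcases h' with rfl | rfl <;> omega
    rw [← card_filter] at h1
    have h4 : #(univ.filter fun j : ZMod q => j ≠ 0 ∧ j ≠ w) = q - 2 := by
      have : (univ.filter fun j : ZMod q => j ≠ 0 ∧ j ≠ w) = (univ.erase 0).erase w := by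
        ext j; simp [and_comm]
      rw [this, card_erase_of_mem (by simp [hw0]), card_erase_of_mem (mem_univ _), card_univ,
        ZMod.card]
      omega
    omega
  obtain ⟨W, x, hxW, hWx, hxW', hlt, hle⟩ := exists_cheapest hk hk1
  set s := ∑ y ∈ W.erase x, (m y - 1) with hs
  have hf := card_pos.2 ⟨x, hxW⟩
  have hfe := card_erase_of_mem hxW
  have hxp := hmp x
  have hs2 : (#W - 1) * (m x - 1) ≤ s := by
    rw [hs, ← hfe, ← smul_eq_mul]
    refine card_nsmul_le_sum _ _ _ fun y hy => ?_
    have := hWx y (mem_of_mem_erase hy)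
    omega
  have hleft : ∀ u : ZMod q → ℕ, (∀ y ∈ W.erase x, u y = m y) → (∀ y ∉ W, u y = 0) →
      u x = k - s + 1 → ∀ y, m y - u y ≤ m x := by
    intro u hu1 hu2 hu3 y
    by_cases hy : y = x
    · subst hy; omega
    by_cases hyW : y ∈ W
    · rw [hu1 y (mem_erase.2 ⟨hy, hyW⟩)]; omega
    · have := hxW' y hyW; omega
  have hn2 : ∀ n, 2 * m x ≤ n → CoverCond (q - 1) (q - 2 - #W) n → Splits m k := by
    intro n hn hc
    refine Splits.of_cheapest hm hxW hWx hlt hle (n := n) ?_ hc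
    intro u hu1 hu2 hu3 y _
    have := hleft u hu1 hu2 hu3 y
    have := hleft u hu1 hu2 hu3 (-y)
    omega
  obtain hf1 | hf2 | hf3 : #W = 1 ∨ #W = 2 ∨ 3 ≤ #W := by omega
  · have hW1 : W.erase x = ∅ := card_eq_zero.1 (by omega)
    have hs0 : s = 0 := by rw [hs, hW1, sum_empty]
    refine Splits.of_single_max hq11 hpq hqo hk1 hkp hm hm0 hmp (x := x) (by omega) fun y => ?_
    by_cases hy : y ∈ W
    · rw [card_eq_one] at hf1
      obtain ⟨w, rfl⟩ := hf1
      rw [mem_singleton] at hy hxW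
      rw [hy, hxW]
    · exact hxW' y hy
  · rw [hf2] at hs2
    have hcov : CoverCond (q - 1) (q - 2 - #W) (q - 7) := by unfold CoverCond; omega
    by_cases h7 : 2 * m x ≤ q - 7
    · exact hn2 _ h7 hcov
    have hq2 : q = 2 * p + 3 ∧ m x = p - 1 ∧ k = p - 1 := by
      obtain ⟨c, rfl⟩ := hqo; omega
    obtain ⟨hqp, hmx, hkp'⟩ := hq2
    obtain ⟨x1, hx1⟩ : ∃ x1, W.erase x = {x1} := card_eq_one.1 (by omega)
    have hx1W : x1 ∈ W.erase x := by rw [hx1]; exact mem_singleton_self _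
    have hs1 : s = m x1 - 1 := by rw [hs, hx1, sum_singleton]
    have hm1 : m x1 = p - 1 := by
      have := hWx x1 (mem_of_mem_erase hx1W)
      omega
    have hx10 : x1 ≠ 0 := by rintro rfl; omega
    have hxx : x1 ≠ x := ne_of_mem_erase hx1W
    have hWm : ∀ y, y ∈ W ↔ y = x ∨ y = x1 := by
      intro y
      have := Finset.ext_iff.1 hx1 y
      rw [mem_erase, mem_singleton] at this
      by_cases hy : y = x
      · simp [hy, hxW]
      · simpa [hy] using this
    by_cases hbad : ∀ y ≠ 0, y ∉ W → -y ∉ W → m y + m (-y) ≤ q - 7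
    · refine Splits.of_cheapest hm hxW hWx hlt hle (n := q - 7) ?_ hcov
      intro u hu1 hu2 hu3 y hy0
      have h1 := hleft u hu1 hu2 hu3 y
      have h2 := hleft u hu1 hu2 hu3 (-y)
      have h3 := hu1 x1 hx1W
      by_cases hyW : y ∈ W
      · rcases (hWm y).1 hyW with rfl | rfl <;> omega
      by_cases hyW' : -y ∈ W
      · rcases (hWm (-y)).1 hyW' with h | h <;> rw [h] at h2 ⊢ <;> omega
      · have := hbad y hy0 hyW hyW'
        omega
    · push Not at hbad
      obtain ⟨y, hy0, hyW, hyW', hy⟩ := hbad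
      have hx0 : x ≠ 0 := by rintro rfl; omega
      have key : ∀ y, y ≠ 0 → y ∉ W → -y ∉ W → m (-y) ≤ m y → q - 7 < m y + m (-y) →
          Splits m k := by
        intro y hy0 hyW hyW' hle' hy
        have h1 := hxW' y hyW
        have h2 := hxW' (-y) hyW'
        have hyn := neg_ne_self_of_ne_zero (by omega) hy0
        rw [hWm, not_or] at hyW hyW'
        have h4 : ∀ z, z ≠ x → z ≠ x1 → z ≠ y → z ≠ -y →
            m x + m x1 + m y + m (-y) + m z ≤ ∑ j, m j := by
          intro z h1 h2 h3 h4
          have : ∑ j ∈ ({x, x1, y, -y, z} : Finset (ZMod q)), m j =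
              m x + m x1 + m y + m (-y) + m z := by
            rw [sum_insert, sum_insert, sum_insert, sum_insert, sum_singleton]
            · ring
            · simpa using h4.symm
            · simp only [mem_insert, mem_singleton, not_or]
              exact ⟨hyn.symm, h3.symm⟩
            · simp only [mem_insert, mem_singleton, not_or]
              exact ⟨fun h => hyW.2 h.symm, fun h => hyW'.2 h.symm, h2.symm⟩
            · simp only [mem_insert, mem_singleton, not_or]
              exact ⟨hxx.symm, fun h => hyW.1 h.symm, fun h => hyW'.1 h.symm, h1.symm⟩
          rw [← this]
          exact sum_le_sum_of_subset (subset_univ _)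
        have h5 := h4 0 hx0.symm hx10.symm hy0.symm (by simpa using hy0)
        have hp5 : p = 5 := by obtain ⟨c, rfl⟩ := hp; omega
        subst hp5
        refine Splits.of_support hm (W := {x, y}) (by simp)
          (u := fun j => if j = y then 4 else if j = x then 2 else 0) ?_ ?_ ?_ (n := q - 7) ?_ ?_
        · intro j
          split_ifs with h h'
          · rw [h]; omega
          · rw [h']; omega
          · omega
        · intro j
          split_ifs with h h' <;> simp [*]
        · rw [card_pair (fun h => hyW.1 h.symm), sum_pair (fun h => hyW.1 h.symm)]
          simp [Ne.symm hyW.1]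
          omega
        · have h6 : ∀ z, z ≠ 0 → z ≠ x → z ≠ x1 → z ≠ y → z ≠ -y → m z = 0 := by
            intro z _ h1 h2 h3 h4'
            have := h4 z h1 h2 h3 h4'
            omega
          have h8 : ∀ z, z ≠ 0 → z ≠ y → z ≠ -y → m z ≤ 4 := by
            intro z z0 z1 z2
            by_cases hzx : z = x
            · rw [hzx]; omega
            by_cases hzx1 : z = x1
            · rw [hzx1]; omega
            · rw [h6 z z0 hzx hzx1 z1 z2]; omega
          have h9 : ∀ z, z ≠ 0 → z ≠ y → z ≠ -y → z ≠ x1 → m z - (if z = x then 2 else 0) ≤ 2 := by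
            intro z z0 z1 z2 z3
            split_ifs with hzx
            · rw [hzx]; omega
            · rw [h6 z z0 hzx z3 z1 z2]; omega
          intro z hz0
          by_cases hzy : z = y
          · rw [if_pos hzy, hzy]; omega
          by_cases hzy' : z = -y
          · rw [hzy', neg_neg, if_pos rfl, if_neg hyn]; omega
          have hzn : -z ≠ y := fun h => hzy' (by rw [← h, neg_neg])
          have hzn' : -z ≠ -y := fun h => hzy (neg_injective h)
          have hz0' : -z ≠ 0 := neg_ne_zero.2 hz0
          have hzz := neg_ne_self_of_ne_zero (by omega) hz0
          rw [if_neg hzy, if_neg hzn]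
          have h10 := h8 z hz0 hzy hzy'
          have h11 := h8 (-z) hz0' hzn hzn'
          by_cases hzx1 : z = x1
          · have := h9 (-z) hz0' hzn hzn' (by rw [hzx1] at hzz ⊢; exact hzz)
            omega
          · have := h9 z hz0 hzy hzy' hzx1
            omega
        · rw [card_pair (fun h => hyW.1 h.symm)]; unfold CoverCond; omega
      rcases le_total (m (-y)) (m y) with h | h
      · exact key y hy0 hyW hyW' h hy
      · exact key (-y) (neg_ne_zero.2 hy0) hyW' (by rwa [neg_neg]) (by rwa [neg_neg])
          (by rw [neg_neg]; omega)
  · obtain ha | ha : m x = 2 ∨ 3 ≤ m x := by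
      have : m x ≠ 1 := by omega
      have : m x ≠ 0 := by omega
      omega
    · have hzW : z ∈ W.erase x := by
        refine mem_erase.2 ⟨by rintro rfl; omega, ?_⟩
        by_contra h
        have := hxW' z h
        omega
      have hfk : #W ≤ s := by
        have h1 := sum_erase_add (W.erase x) (fun y => m y - 1) hzW
        have h2 : #((W.erase x).erase z) * 1 ≤ ∑ y ∈ (W.erase x).erase z, (m y - 1) := by
          rw [← smul_eq_mul]
          refine card_nsmul_le_sum _ _ _ fun y hy => ?_
          have := hWx y (mem_of_mem_erase (mem_of_mem_erase hy))
          omega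
        rw [card_erase_of_mem hzW, hfe] at h2
        rw [← hs] at h1
        omega
      refine hn2 (max 4 ((q - 2 - #W + 2) / 3)) (by omega) ?_
      unfold CoverCond
      obtain ⟨c, rfl⟩ := hqo
      omega
    · obtain ⟨h1, h2⟩ := coverCond_of_mul_le hq11 hpq ha hf3 (by omega)
      exact hn2 _ h1 h2

end

section
variable {p q : ℕ} [hp : Fact p.Prime] [hq : Fact q.Prime] {A : Finset (ZMod p × ZMod q)}

theorem fib_le (j : ZMod q) : fib A j ≤ p := by
  refine le_of_le_of_eq ?_ (card_univ.trans (ZMod.card p))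
  refine card_le_card_of_injOn Prod.fst (fun _ _ => mem_coe.2 (mem_univ _)) fun a ha b hb hab => ?_
  rw [mem_coe, mem_filter] at ha hb
  exact Prod.ext hab (ha.2.trans hb.2.symm)

theorem reach_of_fib_eq_zero (hq11 : 11 ≤ q) (hpq : 2 * p + 3 ≤ q) (hpo : Odd p) (hqo : Odd q)
    (hA0 : 0 ∉ A) (hA : #A + 3 = p + q) (hb : fib A 0 + 2 ≤ p) (hz : ∃ j ≠ 0, fib A j = 0) :
    Reach A := by
  let m : ZMod q → ℕ := fun j => if j = 0 then 0 else fib A j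
  have hm : ∑ j, m j + fib A 0 = #A := by
    rw [← sum_fib, ← add_sum_erase univ (fib A) (mem_univ 0), ← add_sum_erase univ m (mem_univ 0)]
    rw [sum_congr rfl (s₁ := univ.erase 0) (f := m) (g := fib A)
      fun j hj => if_neg (ne_of_mem_erase hj)]
    simp [m, add_comm]
  have hS : Splits m (p - 1 - fib A 0) := by
    refine Splits.of_exists_zero hq11 hpq hqo hpo (by omega) (by omega) (by omega) (by simp [m])
      (fun j => ?_) ?_
    · dsimp only [m]; split_ifs
      · exact Nat.zero_le _
      · exact fib_le j
    · obtain ⟨j, hj, hj'⟩ := hz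
      exact ⟨j, hj, by simp [m, hj']⟩
  obtain ⟨u, hu, hne, hk, n, hn, hc⟩ := hS
  refine reach_of_fib hq11 hA0 u (fun j => (hu j).trans ?_) (Nat.le_zero.1 ((hu 0).trans (by simp [m])))
    hne (by omega) (n := n) (fun x hx => ?_) ?_
  · dsimp only [m]; split_ifs
    · exact Nat.zero_le _
    · exact le_rfl
  · have := hn x hx
    simpa [m, hx] using this
  · convert hc using 1
    omega

/-- Selecting one element in each fiber over `T`, with first coordinates `s`, some value of the
second coordinate is only reached together with a single value of the first one. -/
def Rigid (T : Finset (ZMod q)) (s : ZMod q → ZMod p) : Prop :=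
  ∃ z, ∀ X ⊆ T, ∀ Y ⊆ T, ∑ x ∈ X, x = z → ∑ y ∈ Y, y = z → ∑ x ∈ X, s x = ∑ y ∈ Y, s y

theorem exists_rigid (hp3 : 3 ≤ p) (hA0 : 0 ∉ A) (hA : #A + 3 = p + q) (hb : fib A 0 + 2 ≤ p)
    (hpos : ∀ j ≠ 0, fib A j ≠ 0) (hR : ¬ Reach A) :
    ∃ (T : Finset (ZMod q)) (s : ZMod q → ZMod p), 0 ∉ T ∧ q + 1 ≤ #T + p ∧
      (∀ j ∈ T, (s j, j) ∈ A) ∧ Rigid T s := by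
  obtain ⟨N, hN, hN0, hN1, hN2⟩ : ∃ N : Finset (ZMod q), N.Nonempty ∧ 0 ∉ N ∧
      (∀ j ≠ 0, j ∉ N → fib A j = 1) ∧ (#N = 1 ∨ ∀ j ∈ N, 2 ≤ fib A j) := by
    let N := univ.filter fun j : ZMod q => j ≠ 0 ∧ fib A j ≠ 1
    by_cases h : N.Nonempty
    · refine ⟨N, h, by simp [N], ?_, Or.inr ?_⟩
      · intro j hj hjN
        simpa [N, hj] using hjN
      · intro j hj
        simp only [N, mem_filter, mem_univ, true_and] at hj
        have := hpos j hj.1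
        omega
    · refine ⟨{1}, by simp, by simp, ?_, by simp⟩
      intro j hj _
      rw [not_nonempty_iff_eq_empty] at h
      have : j ∉ N := by simp [h]
      simpa [N, hj] using this
  set T := univ.erase 0 \ N with hT
  have hNs : N ⊆ univ.erase 0 := fun j hj =>
    mem_erase.2 ⟨fun h => hN0 (h ▸ hj), mem_univ _⟩
  have hcT : #T + #N = q - 1 := by
    rw [hT, card_sdiff_add_card_eq_card hNs, card_erase_of_mem (mem_univ _), card_univ, ZMod.card]
  have hs : ∀ j, ∃ a : ZMod p, j ≠ 0 → (a, j) ∈ A := by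
    intro j
    by_cases hj : j = 0
    · exact ⟨0, fun h => absurd hj h⟩
    · obtain ⟨⟨a, i⟩, ha⟩ := card_pos.1 (Nat.pos_of_ne_zero (hpos j hj))
      rw [mem_filter] at ha
      exact ⟨a, fun _ => by rw [← ha.2]; exact ha.1⟩
  choose s hs using hs
  set F := A.filter fun a => a.2 ∈ N with hF
  set Ker := A.filter fun a => a.2 = 0 with hKer
  have him : F.image Prod.snd = N := by
    ext j
    simp only [hF, mem_image, mem_filter]
    constructor
    · rintro ⟨a, ha, rfl⟩; exact ha.2
    · exact fun hj => ⟨(s j, j), ⟨hs j fun h => hN0 (h ▸ hj), hj⟩, rfl⟩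
  have hFc : #F = ∑ j ∈ N, fib A j := by
    rw [card_eq_sum_card_fiberwise (f := Prod.snd) (t := N) fun a ha =>
      mem_coe.2 (mem_filter.1 (mem_coe.1 ha)).2]
    refine sum_congr rfl fun j hj => ?_
    rw [fib, filter_filter]
    congr 1
    ext a
    simp only [mem_filter]
    constructor
    · exact fun h => ⟨h.1, h.2.2⟩
    · exact fun h => ⟨h.1, h.2 ▸ hj, h.2⟩
  have htot : #F + #T + fib A 0 = #A := by
    rw [← sum_fib A, ← sum_erase_add univ _ (mem_univ (0 : ZMod q)), ← sum_sdiff hNs, hFc,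
      sum_congr rfl (s₁ := univ.erase 0 \ N) (g := fun _ => 1) fun j hj => ?_]
    · simp [hT, add_comm]
    · rw [mem_sdiff, mem_erase] at hj
      exact hN1 j hj.1.1 hj.2
  have hN3 : #N + 2 ≤ p := by
    rcases hN2 with h | h
    · omega
    · have := card_nsmul_le_sum N _ _ h
      rw [smul_eq_mul] at this
      change _ ≤ ∑ j ∈ N, fib A j at this
      omega
  have hdisj : Disjoint F Ker := by
    rw [disjoint_left]
    intro a ha h
    rw [mem_filter] at ha h
    exact hN0 (h.2 ▸ ha.2)
  have hK : KGain (F ∪ Ker) (#F - #(F.image Prod.snd) + #Ker) := by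
    refine (kgain_of_nonempty ?_).union_kernel hdisj ?_
    · rwa [← image_nonempty (f := Prod.snd), him]
    · intro a ha
      obtain ⟨h1, h2⟩ := mem_filter.1 ha
      exact ⟨fun h => hA0 (by rwa [show a = 0 from Prod.ext h h2] at h1), h2⟩
  obtain ⟨c, X, hX, hX'⟩ := hK
  have hXc : p ≤ #X + 1 := by
    rw [him] at hX
    change min p (_ + fib A 0 + 1) ≤ _ at hX
    have := hq.out.pos
    omega
  refine ⟨T, s, by simp [hT], by omega, ?_, ?_⟩
  · intro j hj
    rw [hT, mem_sdiff, mem_erase] at hj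
    exact hs j hj.1.1
  · simp only [Reach, not_forall] at hR
    obtain ⟨g, hg⟩ := hR
    have key : ∀ Y ⊆ T, ∑ y ∈ Y, y = g.2 - c → g.1 - ∑ y ∈ Y, s y ∉ X := by
      intro Y hY hYs hx
      obtain ⟨B, hB, hB0, hBs⟩ := hX' _ hx
      have hinj : Function.Injective fun j => (s j, j) := fun i j h => (Prod.ext_iff.1 h).2
      apply hg
      refine ⟨B ∪ Y.image fun j => (s j, j), union_subset (hB.trans ?_) ?_,
        hB0.mono subset_union_left, ?_⟩
      · exact union_subset (filter_subset _ _) (filter_subset _ _)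
      · intro a ha
        obtain ⟨j, hj, rfl⟩ := mem_image.1 ha
        have := hY hj
        rw [hT, mem_sdiff, mem_erase] at this
        exact hs j this.1.1
      · rw [sum_union, hBs, sum_image hinj.injOn]
        · ext
          · simp [Prod.fst_sum]
          · simp [Prod.snd_sum, hYs]
        · rw [disjoint_left]
          intro a ha ha'
          obtain ⟨j, hj, rfl⟩ := mem_image.1 ha'
          have h1 := hY hj
          rw [hT, mem_sdiff, mem_erase] at h1
          rcases mem_union.1 (hB ha) with h | h
          · exact h1.2 (mem_filter.1 h).2
          · exact h1.1.1 (mem_filter.1 h).2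
    refine ⟨g.2 - c, fun Y hY Z hZ hYs hZs => ?_⟩
    by_contra hne
    have h1 := key Y hY hYs
    have h2 := key Z hZ hZs
    have h3 : #(({g.1 - ∑ y ∈ Y, s y, g.1 - ∑ y ∈ Z, s y} : Finset (ZMod p)) ∪ X) ≤ p := by
      simpa [ZMod.card] using card_le_univ
        (({g.1 - ∑ y ∈ Y, s y, g.1 - ∑ y ∈ Z, s y} : Finset (ZMod p)) ∪ X)
    rw [card_union_of_disjoint, card_pair] at h3
    · omega
    · exact fun h => hne (sub_right_injective h)
    · rw [disjoint_left]
      intro a ha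
      rw [mem_insert, mem_singleton] at ha
      rcases ha with rfl | rfl <;> assumption

end

section
variable {p q : ℕ} [hp : Fact p.Prime] [hq : Fact q.Prime] {T U : Finset (ZMod q)}
  {s : ZMod q → ZMod p}

theorem exists_sum_eq_of_coverCond (h11 : 11 ≤ q) (h0 : 0 ∉ U) {n : ℕ} (hn : 2 ≤ n)
    (h : CoverCond (q - 1) #U n) (z : ZMod q) : ∃ X ⊆ U, ∑ x ∈ X, x = z := by
  have hG : Gain (id : ZMod q → ZMod q) U (q - 1) := by
    refine gain_of_coverCond h11 (n := n) (fun i hi h => h0 (by rwa [← show i = 0 from h]))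
      (fun c => le_trans ?_ hn) h
    rcases (U.filter fun i => id i ^ 2 = c).eq_empty_or_nonempty with h | ⟨x, hx⟩
    · rw [h]; simp
    · refine (card_le_card (t := {x, -x}) fun y hy => ?_).trans card_le_two
      rw [mem_filter] at hx hy
      rw [mem_insert, mem_singleton]
      exact sq_eq_sq_iff_eq_or_eq_neg.1 (hy.2.trans hx.2.symm)
  have : z ∈ ssum id U := by rw [hG.ssum_eq_univ]; exact mem_univ _
  exact mem_ssum.1 this

theorem exists_sum_eq (h11 : 11 ≤ q) (h0 : 0 ∉ U) (h6 : 6 ≤ #U) (h : q ≤ 2 * #U + 1) (z : ZMod q) :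
    ∃ X ⊆ U, ∑ x ∈ X, x = z := by
  refine exists_sum_eq_of_coverCond h11 h0 (n := #U / 3) (by omega) ?_ z
  unfold CoverCond
  omega

theorem exists_sum_eq_of_le (h17 : 17 ≤ q) (hpq : 2 * p + 3 ≤ q) (h0 : 0 ∉ U)
    (h : q ≤ #U + p + 3) (z : ZMod q) : ∃ X ⊆ U, ∑ x ∈ X, x = z := by
  refine exists_sum_eq_of_coverCond (by omega) h0 (n := #U / 3) (by omega) ?_ z
  have hp3 : 6 ≤ p → ¬ 3 ∣ p := fun h6 h3 => by
    have := (Nat.prime_dvd_prime_iff_eq Nat.prime_three hp.out).1 h3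
    omega
  have hq2 := hq.out.eq_two_or_odd
  unfold CoverCond
  omega

theorem Rigid.eq_of_sum_eq (h : Rigid T s) {X Y : Finset (ZMod q)} (hX : X ⊆ T) (hY : Y ⊆ T)
    (hXY : ∑ x ∈ X, x = ∑ y ∈ Y, y) (hc : ∀ z, ∃ Z ⊆ T \ (X ∪ Y), ∑ x ∈ Z, x = z) :
    ∑ x ∈ X, s x = ∑ y ∈ Y, s y := by
  obtain ⟨z, h⟩ := h
  obtain ⟨Z, hZ, hZs⟩ := hc (z - ∑ x ∈ X, x)
  have hZT : Z ⊆ T := hZ.trans sdiff_subset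
  have hZX : Disjoint Z X := disjoint_of_subset_left hZ
    (disjoint_of_subset_right subset_union_left disjoint_sdiff.symm)
  have hZY : Disjoint Z Y := disjoint_of_subset_left hZ
    (disjoint_of_subset_right subset_union_right disjoint_sdiff.symm)
  have := h (Z ∪ X) (union_subset hZT hX) (Z ∪ Y) (union_subset hZT hY)
    (by rw [sum_union hZX, hZs]; ring) (by rw [sum_union hZY, hZs, hXY]; ring)
  rw [sum_union hZX, sum_union hZY] at this
  exact add_left_cancel this

theorem Rigid.add (h11 : 11 ≤ q) (hp3 : 3 ≤ p) (hpq : 2 * p + 3 ≤ q) (h : Rigid T s) (h0 : 0 ∉ T)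
    (hT : q + 1 ≤ #T + p) {i j : ZMod q} (hi : i ∈ T) (hj : j ∈ T) (hij : i ≠ j) (hk : i + j ∈ T) :
    s (i + j) = s i + s j := by
  have := h.eq_of_sum_eq (X := {i + j}) (Y := {i, j}) (by simpa using hk)
    (by simp [insert_subset_iff, hi, hj]) (by rw [sum_singleton, sum_pair hij]) ?_
  · rwa [sum_singleton, sum_pair hij] at this
  · have hc : #({i + j} ∪ {i, j} : Finset (ZMod q)) ≤ 3 := card_le_three
    have := le_card_sdiff ({i + j} ∪ {i, j}) T
    have hp2 := hp.out.eq_two_or_odd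
    refine exists_sum_eq h11 (fun h => h0 (mem_sdiff.1 h).1) (by omega) (by omega)

theorem Rigid.add_eq_add_of_ne (h17 : 17 ≤ q) (hpq : 2 * p + 3 ≤ q) (h : Rigid T s) (h0 : 0 ∉ T)
    (hT : q + 1 ≤ #T + p) {i j k l : ZMod q} (hi : i ∈ T) (hj : j ∈ T) (hk : k ∈ T) (hl : l ∈ T)
    (hij : i ≠ j) (hkl : k ≠ l) (hs : i + j = k + l) : s i + s j = s k + s l := by
  have := h.eq_of_sum_eq (X := {i, j}) (Y := {k, l}) (by simp [insert_subset_iff, hi, hj])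
    (by simp [insert_subset_iff, hk, hl]) (by rw [sum_pair hij, sum_pair hkl, hs]) ?_
  · rwa [sum_pair hij, sum_pair hkl] at this
  · have hc : #({i, j} ∪ {k, l} : Finset (ZMod q)) ≤ 4 := by
      refine (card_union_le _ _).trans ?_
      have := card_le_two (a := i) (b := j)
      have := card_le_two (a := k) (b := l)
      omega
    have := le_card_sdiff ({i, j} ∪ {k, l}) T
    refine exists_sum_eq_of_le h17 hpq (fun h => h0 (mem_sdiff.1 h).1) (by omega)

theorem exists_mem_add_mem (hT : q + 5 ≤ 2 * #T) (d : ZMod q) {E : Finset (ZMod q)} (hE : #E ≤ 4) :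
    ∃ m ∈ T, m + d ∈ T ∧ m ∉ E := by
  have h1 : #(T.image (· + d)) = #T := card_image_of_injective _ (add_left_injective d)
  have h2 := card_union_add_card_inter T (T.image (· + d))
  have h3 : #(T ∪ T.image (· + d)) ≤ q := by
    simpa [ZMod.card] using card_le_univ (T ∪ T.image (· + d))
  have h4 : #(E.image (· + d)) ≤ #E := card_image_le
  have h5 := le_card_sdiff (E.image (· + d)) (T ∩ T.image (· + d))
  obtain ⟨x, hx⟩ := card_pos.1 (show 0 < #((T ∩ T.image (· + d)) \ E.image (· + d)) by omega)
  simp only [mem_sdiff, mem_inter, mem_image, not_exists, not_and] at hx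
  obtain ⟨⟨hx1, m, hm, rfl⟩, hx2⟩ := hx
  exact ⟨m, hm, hx1, fun h => hx2 m h rfl⟩

theorem Rigid.two_mul (h17 : 17 ≤ q) (hpq : 2 * p + 3 ≤ q) (h : Rigid T s) (h0 : 0 ∉ T)
    (hT : q + 1 ≤ #T + p) {i k l : ZMod q} (hi : i ∈ T) (hk : k ∈ T) (hl : l ∈ T)
    (hs : i + i = k + l) : s i + s i = s k + s l := by
  by_cases hki : k = i
  · subst hki
    rw [add_left_cancel hs]
  obtain ⟨m, hm, hn, hmE⟩ := exists_mem_add_mem (T := T) (by omega) (i - k)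
    (E := {k, i, k + k - i, l}) card_le_four
  simp only [mem_insert, mem_singleton, not_or] at hmE
  obtain ⟨h1, h2, h3, h4⟩ := hmE
  have e1 := h.add_eq_add_of_ne h17 hpq h0 hT hi hm hk hn (Ne.symm h2)
    (fun hh => h3 (by linear_combination -hh)) (by ring)
  have e2 := h.add_eq_add_of_ne h17 hpq h0 hT hi hn hl hm
    (fun hh => h1 (by linear_combination -hh)) (Ne.symm h4) (by linear_combination hs)
  linear_combination e1 + e2

theorem Rigid.add_eq_add (h17 : 17 ≤ q) (hpq : 2 * p + 3 ≤ q) (h : Rigid T s) (h0 : 0 ∉ T)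
    (hT : q + 1 ≤ #T + p) {i j k l : ZMod q} (hi : i ∈ T) (hj : j ∈ T) (hk : k ∈ T) (hl : l ∈ T)
    (hs : i + j = k + l) : s i + s j = s k + s l := by
  by_cases hij : i = j
  · subst hij
    exact h.two_mul h17 hpq h0 hT hi hk hl hs
  by_cases hkl : k = l
  · subst hkl
    exact (h.two_mul h17 hpq h0 hT hk hi hj hs.symm).symm
  · exact h.add_eq_add_of_ne h17 hpq h0 hT hi hj hk hl hij hkl hs

theorem map_eq_of_add_left (hpq : p ≠ q) {d : ZMod q} (hd : d ≠ 0) {c : ZMod p}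
    (h : ∀ x, s (x + d) = s x + c) (x y : ZMod q) : s x = s y := by
  have hn : ∀ (n : ℕ) x, s (x + n * d) = s x + n * c := by
    intro n
    induction n with
    | zero => simp
    | succ n ih =>
      intro x
      rw [show x + (n + 1 : ℕ) * d = x + n * d + d by push_cast; ring, h, ih]
      push_cast; ring
  have hc : c = 0 := by
    have h1 := hn q 0
    rw [CharP.cast_eq_zero, zero_mul, add_zero] at h1
    have h2 : (q : ZMod p) * c = 0 := by linear_combination -h1
    rcases mul_eq_zero.1 h2 with h | h
    · rw [ZMod.natCast_eq_zero_iff, Nat.prime_dvd_prime_iff_eq hp.out hq.out] at h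
      exact absurd h hpq
    · exact h
  have := hn ((y - x) * d⁻¹).val x
  rw [hc, mul_zero, add_zero, ZMod.natCast_zmod_val, mul_assoc, inv_mul_cancel₀ hd, mul_one,
    add_sub_cancel] at this
  exact this.symm

theorem map_eq_of_add_eq_add (hpq : p ≠ q) {T₁ T₂ : Finset (ZMod q)} {s₁ s₂ : ZMod q → ZMod p}
    (hT : q + 2 ≤ #T₁ + #T₂)
    (h : ∀ i ∈ T₁, ∀ i' ∈ T₁, ∀ j ∈ T₂, ∀ j' ∈ T₂, i + j = i' + j' → s₁ i + s₂ j = s₁ i' + s₂ j') :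
    ∀ x ∈ T₁, ∀ y ∈ T₁, s₁ x = s₁ y := by
  induction hn : #T₂ using Nat.strong_induction_on generalizing T₁ T₂ s₁ s₂ with
  | _ n ih =>
  have hc1 : #T₁ ≤ q := by simpa [ZMod.card] using card_le_univ T₁
  obtain ⟨j, hj, j', hj', hjj⟩ := one_lt_card.1 (show 1 < #T₂ by omega)
  have hd : j' - j ≠ 0 := sub_ne_zero.2 hjj.symm
  by_cases hcl : ∀ x ∈ T₁, x + (j' - j) ∈ T₁
  · have hu : ∀ x, x ∈ T₁ := by
      obtain ⟨y, hy⟩ : T₁.Nonempty := by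
        have : #T₂ ≤ q := by simpa [ZMod.card] using card_le_univ T₂
        exact card_pos.1 (by omega)
      have hn : ∀ n : ℕ, y + n * (j' - j) ∈ T₁ := by
        intro n
        induction n with
        | zero => simpa using hy
        | succ n ih => convert hcl _ ih using 1; push_cast; ring
      intro x
      have := hn ((x - y) * (j' - j)⁻¹).val
      rwa [ZMod.natCast_zmod_val, mul_assoc, inv_mul_cancel₀ hd, mul_one, add_sub_cancel] at this
    exact fun x _ y _ => map_eq_of_add_left hpq hd (c := s₂ j' - s₂ j) (fun x => by
      have := h (x + (j' - j)) (hu _) x (hu _) j hj j' hj' (by ring)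
      linear_combination this) x y
  · push Not at hcl
    obtain ⟨x, hx, hx'⟩ := hcl
    let e := x - j
    let c := s₁ x - s₂ j
    let s₁' : ZMod q → ZMod p := fun y => if y ∈ T₁ then s₁ y else s₂ (y - e) + c
    have hov : ∀ y ∈ T₁, y - e ∈ T₂ → s₁ y = s₂ (y - e) + c := by
      intro y hy hye
      have := h y hy x hx j hj (y - e) hye (by simp only [e]; ring)
      simp only [c]
      linear_combination this
    have hcA : #(T₁ ∪ T₂.image (· + e)) + #(T₂.filter fun y => y + e ∈ T₁) = #T₁ + #T₂ := by
      have h1 : #(T₂.image (· + e)) = #T₂ := card_image_of_injective _ (add_left_injective e)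
      have h2 := card_union_add_card_inter T₁ (T₂.image (· + e))
      have h3 : (T₂.filter fun y => y + e ∈ T₁).image (· + e) = T₁ ∩ T₂.image (· + e) := by
        ext y
        simp only [mem_image, mem_filter, mem_inter]
        constructor
        · rintro ⟨z, ⟨hz, hz'⟩, rfl⟩; exact ⟨hz', z, hz, rfl⟩
        · rintro ⟨hy, z, hz, rfl⟩; exact ⟨z, ⟨hz, hy⟩, rfl⟩
      rw [← h3, card_image_of_injective _ (add_left_injective e)] at h2
      omega
    have hlt : #(T₂.filter fun y => y + e ∈ T₁) < n := by
      rw [← hn]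
      refine card_lt_card (filter_ssubset.2 ⟨j', hj', fun hh => hx' ?_⟩)
      convert hh using 1
      simp only [e]; ring
    have key : ∀ i ∈ T₁ ∪ T₂.image (· + e), ∀ k ∈ T₂.filter fun y => y + e ∈ T₁,
        ∃ i' ∈ T₁, ∃ k' ∈ T₂, i' + k' = i + k ∧ s₁ i' + s₂ k' = s₁' i + s₂ k := by
      intro i hi k hk
      rw [mem_filter] at hk
      by_cases hi1 : i ∈ T₁
      · exact ⟨i, hi1, k, hk.1, rfl, by simp [s₁', hi1]⟩
      · have hi2 := (mem_union.1 hi).resolve_left hi1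
        obtain ⟨l, hl, rfl⟩ := mem_image.1 hi2
        refine ⟨k + e, hk.2, l, hl, by ring, ?_⟩
        have := hov (k + e) hk.2 (by simpa using hk.1)
        simp only [s₁', hi1, if_false, this, add_sub_cancel_right]
        ring
    have := ih _ hlt (T₁ := T₁ ∪ T₂.image (· + e)) (T₂ := T₂.filter fun y => y + e ∈ T₁)
      (s₁ := s₁') (s₂ := s₂) (by omega) (by
        intro i hi i' hi' k hk k' hk' heq
        obtain ⟨a, ha, b, hb, h1, h2⟩ := key i hi k hk
        obtain ⟨a', ha', b', hb', h1', h2'⟩ := key i' hi' k' hk'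
        rw [← h2, ← h2']
        exact h a ha a' ha' b hb b' hb' (by rw [h1, h1', heq])) rfl
    intro y hy z hz
    have := this y (mem_union_left _ hy) z (mem_union_left _ hz)
    simpa [s₁', hy, hz] using this

theorem Rigid.eq_zero (h17 : 17 ≤ q) (hp3 : 3 ≤ p) (hpq : 2 * p + 3 ≤ q) (h : Rigid T s)
    (h0 : 0 ∉ T) (hT : q + 1 ≤ #T + p) : ∀ x ∈ T, s x = 0 := by
  have hconst := map_eq_of_add_eq_add (p := p) (by omega) (T₁ := T) (T₂ := T) (s₁ := s) (s₂ := s)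
    (by omega) fun i hi i' hi' j hj j' hj' => h.add_eq_add h17 hpq h0 hT hi hj hi' hj'
  obtain ⟨d, hd⟩ := card_pos.1 (show 0 < #T by omega)
  obtain ⟨m, hm, hn, hmE⟩ := exists_mem_add_mem (T := T) (by omega) d (E := {d}) (by simp)
  have h1 := h.add (by omega) hp3 hpq h0 hT hm hd (by simpa using hmE) hn
  intro x hx
  rw [hconst _ hn x hx, hconst m hm x hx, hconst d hd x hx] at h1
  exact left_eq_add.1 h1

end

instance fact_prime_eleven : Fact (Nat.Prime 11) := ⟨by norm_num⟩

instance fact_prime_thirteen : Fact (Nat.Prime 13) := ⟨by norm_num⟩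

/-- Any two nonzero classes and `1` miss, up to a dilation, the classes `1, …, 5` together with one
of three further configurations modulo `13`. -/
theorem exists_dilate_thirteen : ∀ b c : ZMod 13, ∃ t : ZMod 13, t ≠ 0 ∧
    (∀ i ∈ ([1, 2, 3, 4, 5] : List (ZMod 13)), i * t ∉ [1, b, c]) ∧
    ∃ l ∈ ([[9], [8, 10, 11], [7, 10]] : List (List (ZMod 13))), ∀ i ∈ l, i * t ∉ [1, b, c] := by
  decide +kernel

theorem exists_dilate_eleven : ∃ t : ZMod 11, t ≠ 0 ∧
    ∀ i ∈ ([1, 2, 3, 4, 5, 9] : List (ZMod 11)), i * t ≠ 1 := by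
  decide +kernel

theorem exists_subset_sum_thirteen : ∀ y : ZMod 13,
    ∃ B ∈ ({1, 2, 3, 4, 5} : Finset (ZMod 13)).powerset, B ≠ ∅ ∧ ∑ x ∈ B, x = y := by
  decide +kernel

theorem exists_subset_sum_eleven : ∀ y : ZMod 11,
    ∃ B ∈ ({1, 2, 3, 4, 5} : Finset (ZMod 11)).powerset, B ≠ ∅ ∧ ∑ x ∈ B, x = y := by
  decide +kernel

section
variable {p : ℕ} [hp : Fact p.Prime]

theorem map_run_eq {R : Type*} [AddGroupWithOne R] {M : Type*} [CommRing M] {P : R → Prop} {f : R → M}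
    (h12 : (1 : R) ≠ 2) (h13 : (1 : R) ≠ 3) (h14 : (1 : R) ≠ 4) (h23 : (2 : R) ≠ 3)
    (h : ∀ x y, x ≠ y → P x → P y → P (x + y) → f (x + y) = f x + f y)
    (h1 : P 1) (h2 : P 2) (h3 : P 3) (h4 : P 4) (h5 : P 5) :
    f 2 = 2 * f 1 ∧ f 3 = 3 * f 1 ∧ f 4 = 4 * f 1 ∧ f 5 = 5 * f 1 := by
  have e3 := h 1 2 h12 h1 h2
  have e4 := h 1 3 h13 h1 h3
  have e5 := h 1 4 h14 h1 h4
  have e5' := h 2 3 h23 h2 h3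
  rw [show (1 : R) + 2 = 3 by norm_num] at e3
  rw [show (1 : R) + 3 = 4 by norm_num] at e4
  rw [show (1 : R) + 4 = 5 by norm_num] at e5
  rw [show (2 : R) + 3 = 5 by norm_num] at e5'
  have e3 := e3 h3
  have e4 := e4 h4
  have e5 := e5 h5
  have e5' := e5' h5
  have e2 : f 2 = 2 * f 1 := by linear_combination e5 - e5' + e4
  refine ⟨e2, ?_, ?_, ?_⟩
  · linear_combination e3 + e2
  · linear_combination e4 + e3 + e2
  · linear_combination e5 + e4 + e3 + e2


theorem natCast_mul_eq_zero {q : ℕ} (hq : q.Prime) (hpq : p ≠ q) {x : ZMod p}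
    (h : (q : ZMod p) * x = 0) : x = 0 := by
  refine (mul_eq_zero.1 h).resolve_left fun h => hpq ?_
  rwa [ZMod.natCast_eq_zero_iff, Nat.prime_dvd_prime_iff_eq hp.out hq] at h

theorem exists_dilate {q : ℕ} [hq : Fact q.Prime] {T : Finset (ZMod q)} {s : ZMod q → ZMod p}
    {t : ZMod q} (ht : t ≠ 0) {B : Finset (ZMod q)} (hB : ∀ x ∈ B, x * t ∈ T)
    (hs : ∀ x ∈ B, s (x * t) = 0) (hsum : ∀ y, ∃ X ∈ B.powerset, X ≠ ∅ ∧ ∑ x ∈ X, x = y) :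
    ∃ T' ⊆ T, (∀ x ∈ T', s x = 0) ∧ ∀ y, ∃ X ⊆ T', X.Nonempty ∧ ∑ x ∈ X, x = y := by
  refine ⟨B.image (· * t), ?_, ?_, fun y => ?_⟩
  · intro x hx
    obtain ⟨y, hy, rfl⟩ := mem_image.1 hx
    exact hB y hy
  · intro x hx
    obtain ⟨y, hy, rfl⟩ := mem_image.1 hx
    exact hs y hy
  · obtain ⟨X, hX, hX0, hXs⟩ := hsum (y * t⁻¹)
    refine ⟨X.image (· * t), image_subset_image (mem_powerset.1 hX),
      (nonempty_iff_ne_empty.2 hX0).image _, ?_⟩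
    rw [sum_image (mul_left_injective₀ ht).injOn, ← sum_mul, hXs, mul_assoc, inv_mul_cancel₀ ht,
      mul_one]

theorem map_run_eq_zero {R M : Type*} [AddGroupWithOne R] [DecidableEq R] [CommRing M] {f : R → M}
    (h : f 2 = 2 * f 1 ∧ f 3 = 3 * f 1 ∧ f 4 = 4 * f 1 ∧ f 5 = 5 * f 1) (h1 : f 1 = 0) :
    ∀ x ∈ ({1, 2, 3, 4, 5} : Finset R), f x = 0 := by
  obtain ⟨h2, h3, h4, h5⟩ := h
  intro x hx
  simp only [mem_insert, mem_singleton] at hx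
  rcases hx with rfl | rfl | rfl | rfl | rfl <;> simp [*]

theorem Rigid.exists_of_eleven {T : Finset (ZMod 11)}
    {s : ZMod 11 → ZMod p} (hp3 : 3 ≤ p) (hpq : 2 * p + 3 ≤ 11) (h : Rigid T s) (h0 : 0 ∉ T)
    (hT : 11 + 1 ≤ #T + p) :
    ∃ T' ⊆ T, (∀ x ∈ T', s x = 0) ∧ ∀ y, ∃ X ⊆ T', X.Nonempty ∧ ∑ x ∈ X, x = y := by
  have hpo := hp.out.eq_two_or_odd
  have hTs : T ⊆ univ.erase 0 := fun x hx => mem_erase.2 ⟨fun hh => h0 (hh ▸ hx), mem_univ _⟩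
  have hcard : #(univ.erase 0 \ T) + #T = 10 := by
    rw [card_sdiff_add_card_eq_card hTs]; rfl
  obtain ⟨C, hTC, hC, hC1⟩ := exists_subsuperset_card_eq (sdiff_subset (s := univ.erase 0) (t := T))
    (show #(univ.erase 0 \ T) ≤ 1 by omega) (by decide)
  obtain ⟨a, rfl⟩ := card_eq_one.1 hC1
  have ha : a ≠ 0 := by simpa using hC
  obtain ⟨t, ht, hmem⟩ := exists_dilate_eleven
  have hmT : ∀ i ∈ ([1, 2, 3, 4, 5, 9] : List (ZMod 11)), i ≠ 0 → i * (t * a) ∈ T := by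
    intro i hi hi0
    by_contra hcon
    have := hTC (mem_sdiff.2 ⟨mem_erase.2 ⟨mul_ne_zero hi0 (mul_ne_zero ht ha), mem_univ _⟩, hcon⟩)
    rw [mem_singleton, ← mul_assoc] at this
    exact hmem i hi (mul_right_cancel₀ ha (this.trans (one_mul a).symm))
  set u := t * a with hu
  have hu0 : u ≠ 0 := mul_ne_zero ht ha
  have hadd : ∀ x y, x ≠ y → x * u ∈ T → y * u ∈ T → (x + y) * u ∈ T →
      s ((x + y) * u) = s (x * u) + s (y * u) := by
    intro x y hxy hx hy hxy'
    rw [add_mul] at hxy' ⊢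
    exact h.add le_rfl hp3 hpq h0 hT hx hy (fun hh => hxy (mul_right_cancel₀ hu0 hh)) hxy'
  have m1 := hmT 1 (by decide) (by decide)
  have m2 := hmT 2 (by decide) (by decide)
  have m3 := hmT 3 (by decide) (by decide)
  have m4 := hmT 4 (by decide) (by decide)
  have m5 := hmT 5 (by decide) (by decide)
  have m9 := hmT 9 (by decide) (by decide)
  have hrun := map_run_eq (P := fun x => x * u ∈ T) (f := fun x => s (x * u)) (by decide)
    (by decide) (by decide) (by decide) hadd m1 m2 m3 m4 m5
  have e9 := hadd 4 5 (by decide) m4 m5 m9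
  have e1 := hadd 9 3 (by decide) m9 m3 m1
  rw [show (4 + 5 : ZMod 11) = 9 by decide] at e9
  rw [show (9 + 3 : ZMod 11) = 1 by decide] at e1
  have hz : s (1 * u) = 0 := by
    refine natCast_mul_eq_zero fact_prime_eleven.out (by omega) ?_
    push_cast
    linear_combination -e1 - e9 - hrun.2.1 - hrun.2.2.1 - hrun.2.2.2
  refine exists_dilate hu0 (B := {1, 2, 3, 4, 5}) ?_
    (map_run_eq_zero (f := fun x => s (x * u)) hrun hz) exists_subset_sum_eleven
  intro x hx
  simp only [mem_insert, mem_singleton] at hx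
  rcases hx with rfl | rfl | rfl | rfl | rfl <;> assumption

theorem Rigid.exists_of_thirteen {T : Finset (ZMod 13)}
    {s : ZMod 13 → ZMod p} (hp3 : 3 ≤ p) (hpq : 2 * p + 3 ≤ 13) (h : Rigid T s) (h0 : 0 ∉ T)
    (hT : 13 + 1 ≤ #T + p) :
    ∃ T' ⊆ T, (∀ x ∈ T', s x = 0) ∧ ∀ y, ∃ X ⊆ T', X.Nonempty ∧ ∑ x ∈ X, x = y := by
  have hTs : T ⊆ univ.erase 0 := fun x hx => mem_erase.2 ⟨fun hh => h0 (hh ▸ hx), mem_univ _⟩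
  have hcard : #(univ.erase 0 \ T) + #T = 12 := by
    rw [card_sdiff_add_card_eq_card hTs]; rfl
  obtain ⟨C, hTC, hC, hC1⟩ := exists_subsuperset_card_eq (sdiff_subset (s := univ.erase 0) (t := T))
    (show #(univ.erase 0 \ T) ≤ 3 by omega) (by decide)
  obtain ⟨a, b, c, -, -, -, rfl⟩ := card_eq_three.1 hC1
  have ha : a ≠ 0 := ne_of_mem_erase (hC (mem_insert_self _ _))
  obtain ⟨t, ht, hmem, l, hl, hmem'⟩ := exists_dilate_thirteen (b * a⁻¹) (c * a⁻¹)
  set u := t * a with hu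
  have hu0 : u ≠ 0 := mul_ne_zero ht ha
  have hmT : ∀ i, i ≠ 0 → i * t ∉ [1, b * a⁻¹, c * a⁻¹] → i * u ∈ T := by
    intro i hi0 hi
    by_contra hcon
    have := hTC (mem_sdiff.2 ⟨mem_erase.2 ⟨mul_ne_zero hi0 hu0, mem_univ _⟩, hcon⟩)
    rw [hu, ← mul_assoc] at this
    simp only [mem_insert, mem_singleton] at this
    simp only [List.mem_cons, List.not_mem_nil, or_false] at hi
    apply hi
    rcases this with h | h | h
    · exact Or.inl (mul_right_cancel₀ ha (h.trans (one_mul a).symm))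
    · exact Or.inr (Or.inl (by rw [← h, mul_assoc (i * t), mul_inv_cancel₀ ha, mul_one]))
    · exact Or.inr (Or.inr (by rw [← h, mul_assoc (i * t), mul_inv_cancel₀ ha, mul_one]))
  have hadd : ∀ x y, x ≠ y → x * u ∈ T → y * u ∈ T → (x + y) * u ∈ T →
      s ((x + y) * u) = s (x * u) + s (y * u) := by
    intro x y hxy hx hy hxy'
    rw [add_mul] at hxy' ⊢
    exact h.add (by norm_num) hp3 hpq h0 hT hx hy (fun hh => hxy (mul_right_cancel₀ hu0 hh)) hxy'
  have m1 := hmT 1 (by decide) (hmem 1 (by decide))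
  have m2 := hmT 2 (by decide) (hmem 2 (by decide))
  have m3 := hmT 3 (by decide) (hmem 3 (by decide))
  have m4 := hmT 4 (by decide) (hmem 4 (by decide))
  have m5 := hmT 5 (by decide) (hmem 5 (by decide))
  have hrun := map_run_eq (P := fun x => x * u ∈ T) (f := fun x => s (x * u)) (by decide)
    (by decide) (by decide) (by decide) hadd m1 m2 m3 m4 m5
  have hz : s (1 * u) = 0 := by
    refine natCast_mul_eq_zero fact_prime_thirteen.out (by omega) ?_
    push_cast
    obtain ⟨r2, r3, r4, r5⟩ := hrun
    simp only [List.mem_cons, List.not_mem_nil, or_false] at hl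
    rcases hl with rfl | rfl | rfl
    · have m9 := hmT 9 (by decide) (hmem' 9 (by decide))
      have e9 := hadd 4 5 (by decide) m4 m5 m9
      have e1 := hadd 9 5 (by decide) m9 m5 m1
      rw [show (4 + 5 : ZMod 13) = 9 by decide] at e9
      rw [show (9 + 5 : ZMod 13) = 1 by decide] at e1
      linear_combination -e1 - e9 - r4 - 2 * r5
    · have m8 := hmT 8 (by decide) (hmem' 8 (by decide))
      have m10 := hmT 10 (by decide) (hmem' 10 (by decide))
      have m11 := hmT 11 (by decide) (hmem' 11 (by decide))
      have e8 := hadd 3 5 (by decide) m3 m5 m8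
      have e1 := hadd 10 4 (by decide) m10 m4 m1
      have e1' := hadd 11 3 (by decide) m11 m3 m1
      have e8' := hadd 10 11 (by decide) m10 m11 m8
      rw [show (3 + 5 : ZMod 13) = 8 by decide] at e8
      rw [show (10 + 4 : ZMod 13) = 1 by decide] at e1
      rw [show (11 + 3 : ZMod 13) = 1 by decide] at e1'
      rw [show (10 + 11 : ZMod 13) = 8 by decide] at e8'
      linear_combination e8' - e8 - e1 - e1' - 2 * r3 - r4 - r5
    · have m7 := hmT 7 (by decide) (hmem' 7 (by decide))
      have m10 := hmT 10 (by decide) (hmem' 10 (by decide))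
      have e7 := hadd 2 5 (by decide) m2 m5 m7
      have e1 := hadd 10 4 (by decide) m10 m4 m1
      have e10 := hadd 7 3 (by decide) m7 m3 m10
      rw [show (2 + 5 : ZMod 13) = 7 by decide] at e7
      rw [show (10 + 4 : ZMod 13) = 1 by decide] at e1
      rw [show (7 + 3 : ZMod 13) = 10 by decide] at e10
      linear_combination -e7 - e1 - e10 - r2 - r3 - r4 - r5
  refine exists_dilate hu0 (B := {1, 2, 3, 4, 5}) ?_
    (map_run_eq_zero (f := fun x => s (x * u)) hrun hz) exists_subset_sum_thirteen
  intro x hx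
  simp only [mem_insert, mem_singleton] at hx
  rcases hx with rfl | rfl | rfl | rfl | rfl <;> assumption

theorem Rigid.exists_subset {q : ℕ} [hq : Fact q.Prime] {T : Finset (ZMod q)}
    {s : ZMod q → ZMod p} (hp3 : 3 ≤ p) (h11 : 11 ≤ q) (hpq : 2 * p + 3 ≤ q) (h : Rigid T s)
    (h0 : 0 ∉ T) (hT : q + 1 ≤ #T + p) :
    ∃ T' ⊆ T, (∀ x ∈ T', s x = 0) ∧ ∀ y, ∃ X ⊆ T', X.Nonempty ∧ ∑ x ∈ X, x = y := by
  by_cases h17 : 17 ≤ q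
  · refine ⟨T, Subset.rfl, h.eq_zero h17 hp3 hpq h0 hT, fun y => ?_⟩
    obtain ⟨a, ha⟩ := card_pos.1 (show 0 < #T by omega)
    obtain ⟨X, hX, hXs⟩ := exists_sum_eq h11 (U := T.erase a) (fun h => h0 (mem_of_mem_erase h))
      (by rw [card_erase_of_mem ha]; omega) (by rw [card_erase_of_mem ha]; omega) (y - a)
    refine ⟨insert a X, insert_subset ha (hX.trans (erase_subset _ _)), insert_nonempty _ _, ?_⟩
    rw [sum_insert (fun h => notMem_erase a T (hX h)), hXs]
    ring
  · have hq13 : q = 11 ∨ q = 13 := by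
      have hqp := hq.out
      interval_cases q <;>
        first | exact Or.inl rfl | exact Or.inr rfl | exact absurd hqp (by norm_num)
    rcases hq13 with rfl | rfl
    · exact h.exists_of_eleven hp3 hpq h0 hT
    · exact h.exists_of_thirteen hp3 hpq h0 hT

end

section

variable {p q : ℕ} [Fact p.Prime] [Fact q.Prime]

theorem exists_complete_of_card {A : Finset (ZMod p × ZMod q)} (hpo : Odd p) (hqo : Odd q)
    (hpq : 2 * p + 3 ≤ q) (hA0 : 0 ∉ A) (hA : #A + 3 = p + q) :
    ∃ A' ⊆ A, A'.Nonempty ∧ ∃ L : AddSubgroup (ZMod p × ZMod q), (∀ a ∈ A', a ∈ L) ∧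
      ∀ g ∈ L, ∃ B ⊆ A', B.Nonempty ∧ ∑ b ∈ B, b = g := by
  have hp := Fact.out (p := p.Prime)
  have hq := Fact.out (p := q.Prime)
  have hp3 : 3 ≤ p := by
    have := hp.two_le
    rcases hpo with ⟨k, rfl⟩
    omega
  have h11 : 11 ≤ q := by
    by_contra hlt
    have h9 : q = 9 := by
      rcases hqo with ⟨k, rfl⟩
      omega
    rw [h9] at hq
    exact absurd hq (by norm_num)
  have hne : A.Nonempty := card_pos.1 (by omega)
  by_cases hR : Reach A
  · exact ⟨A, Subset.rfl, hne, ⊤, fun _ _ => AddSubgroup.mem_top _, fun g _ => hR g⟩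
  by_cases hb : fib A 0 + 2 ≤ p
  · have hpos : ∀ j ≠ 0, fib A j ≠ 0 := fun j hj hz =>
      hR (reach_of_fib_eq_zero h11 hpq hpo hqo hA0 hA hb ⟨j, hj, hz⟩)
    obtain ⟨T, s, hT0, hT, hTA, hrig⟩ := exists_rigid hp3 hA0 hA hb hpos hR
    obtain ⟨T', hT'T, hs, hsum⟩ := hrig.exists_subset hp3 h11 hpq hT0 hT
    have hinj : Function.Injective fun j : ZMod q => ((0 : ZMod p), j) := fun x y h =>
      (Prod.ext_iff.1 h).2
    obtain ⟨X, hX, hXne, -⟩ := hsum 0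
    refine ⟨T'.image fun j => (0, j), ?_, (hXne.mono hX).image _,
      (AddMonoidHom.fst (ZMod p) (ZMod q)).ker, ?_, ?_⟩
    · intro a ha
      obtain ⟨j, hj, rfl⟩ := mem_image.1 ha
      rw [← hs j hj]
      exact hTA j (hT'T hj)
    · intro a ha
      obtain ⟨j, hj, rfl⟩ := mem_image.1 ha
      rfl
    · rintro ⟨x, y⟩ hg
      obtain rfl : x = 0 := hg
      obtain ⟨Y, hY, hYne, hYs⟩ := hsum y
      refine ⟨Y.image fun j => (0, j), image_subset_image hY, hYne.image _, ?_⟩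
      rw [sum_image hinj.injOn]
      ext
      · simp [Prod.fst_sum]
      · simp [Prod.snd_sum, hYs]
  · have hK : ∀ x : ZMod p, x ≠ 0 → (x, (0 : ZMod q)) ∈ A := by
      intro x hx
      by_contra hxA
      have hsub : A.filter (fun a => a.2 = 0) ⊆
          ((univ.erase 0).erase x).image fun z : ZMod p => (z, (0 : ZMod q)) := by
        rintro ⟨a, b⟩ hab
        obtain ⟨haA, rfl⟩ : (a, b) ∈ A ∧ b = 0 := mem_filter.1 hab
        refine mem_image.2 ⟨a, mem_erase.2 ⟨?_, mem_erase.2 ⟨?_, mem_univ _⟩⟩, rfl⟩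
        · rintro rfl
          exact hxA haA
        · rintro rfl
          exact hA0 haA
      have hc := (card_le_card hsub).trans card_image_le
      rw [card_erase_of_mem (mem_erase.2 ⟨hx, mem_univ _⟩), card_erase_of_mem (mem_univ _),
        card_univ, ZMod.card] at hc
      unfold fib at hb
      omega
    refine ⟨A.filter fun a => a.2 = 0, filter_subset _ _,
      ⟨(1, 0), mem_filter.2 ⟨hK 1 one_ne_zero, rfl⟩⟩,
      (AddMonoidHom.snd (ZMod p) (ZMod q)).ker, fun a ha => (mem_filter.1 ha).2, ?_⟩
    rintro ⟨x, y⟩ hg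
    obtain rfl : y = 0 := hg
    by_cases hx : x = 0
    · subst hx
      have h1 : ((1 : ZMod p), (0 : ZMod q)) ≠ (-1, 0) := by
        intro h
        have : Fact (2 < p) := ⟨by omega⟩
        exact ZMod.neg_one_ne_one (Prod.ext_iff.1 h).1.symm
      refine ⟨{(1, 0), (-1, 0)}, ?_, insert_nonempty _ _, ?_⟩
      · intro a ha
        rw [mem_insert, mem_singleton] at ha
        rcases ha with rfl | rfl
        · exact mem_filter.2 ⟨hK 1 one_ne_zero, rfl⟩
        · exact mem_filter.2 ⟨hK (-1) (neg_ne_zero.2 one_ne_zero), rfl⟩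
      · rw [sum_pair h1]
        simp
    · exact ⟨{(x, 0)}, singleton_subset_iff.2 (mem_filter.2 ⟨hK x hx, rfl⟩),
        singleton_nonempty _, sum_singleton _ _⟩

theorem exists_card_and_not_reach (hp3 : 3 ≤ p) (hpq : p ≤ q) :
    ∃ S : Finset (ZMod p × ZMod q), 0 ∉ S ∧ #S + 3 = p + q ∧ ¬ Reach S := by
  have hinj : Set.InjOn (fun k : ℕ => ((1 : ZMod p), (k : ZMod q))) (range (p - 2)) := by
    intro a ha b hb h
    have ha' : a < p - 2 := mem_range.1 ha
    have hb' : b < p - 2 := mem_range.1 hb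
    have h2 := (ZMod.natCast_eq_natCast_iff' a b q).1 (Prod.ext_iff.1 h).2
    rwa [Nat.mod_eq_of_lt (by omega), Nat.mod_eq_of_lt (by omega)] at h2
  set V := (univ.erase (0 : ZMod q)).image fun j => ((0 : ZMod p), j) with hV
  set W := (range (p - 2)).image fun k : ℕ => ((1 : ZMod p), (k : ZMod q)) with hW
  have hVfst : ∀ a ∈ V, a.1 = 0 := by
    intro a ha
    obtain ⟨j, -, rfl⟩ := mem_image.1 ha
    rfl
  have hWfst : ∀ a ∈ W, a.1 = 1 := by
    intro a ha
    obtain ⟨j, -, rfl⟩ := mem_image.1 ha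
    rfl
  have hVcard : #V = q - 1 := by
    rw [hV, card_image_of_injective _ (Prod.mk_right_injective _), card_erase_of_mem (mem_univ _),
      card_univ, ZMod.card]
  have hWcard : #W = p - 2 := by rw [hW, card_image_of_injOn hinj, card_range]
  refine ⟨V ∪ W, ?_, ?_, fun hR => ?_⟩
  · intro h0
    rcases mem_union.1 h0 with h | h
    · obtain ⟨j, hj, hj0⟩ := mem_image.1 h
      exact (mem_erase.1 hj).1 (Prod.ext_iff.1 hj0).2
    · exact zero_ne_one (hWfst _ h)
  · rw [card_union_of_disjoint, hVcard, hWcard]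
    · omega
    · refine disjoint_left.2 fun a ha ha' => zero_ne_one (α := ZMod p) ?_
      rw [← hVfst a ha, hWfst a ha']
  · obtain ⟨B, hB, -, hs⟩ := hR (-1, 0)
    have hfst : ∑ b ∈ B, b.1 = -1 := by rw [← Prod.fst_sum, hs]
    have hcount : ∑ b ∈ B, b.1 = (#(B.filter fun b => b ∈ W) : ZMod p) := by
      rw [card_filter, Nat.cast_sum]
      refine sum_congr rfl fun b hb => ?_
      by_cases hbW : b ∈ W
      · rw [if_pos hbW, hWfst b hbW, Nat.cast_one]
      · rw [if_neg hbW, hVfst b ((mem_union.1 (hB hb)).resolve_right hbW), Nat.cast_zero]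
    have hle : #(B.filter fun b => b ∈ W) ≤ p - 2 :=
      hWcard ▸ card_le_card fun b hb => (mem_filter.1 hb).2
    have hdvd : ((#(B.filter fun b => b ∈ W) + 1 : ℕ) : ZMod p) = 0 := by
      rw [Nat.cast_add, ← hcount, hfst]
      simp
    have := Nat.le_of_dvd (Nat.succ_pos _) ((ZMod.natCast_eq_zero_iff _ _).1 hdvd)
    omega

theorem nonempty_addEquiv_zmod_prod {G : Type*} [AddCommGroup G] [Fintype G]
    (hpq : p ≠ q) (hG : Fintype.card G = p * q) : Nonempty (G ≃+ ZMod p × ZMod q) := by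
  have hco : p.Coprime q := (Nat.coprime_primes Fact.out Fact.out).2 hpq
  obtain ⟨x, hx⟩ := exists_prime_addOrderOf_dvd_card p (G := G) (hG ▸ dvd_mul_right p q)
  obtain ⟨y, hy⟩ := exists_prime_addOrderOf_dvd_card q (G := G) (hG ▸ dvd_mul_left q p)
  have hxy : addOrderOf (x + y) = p * q := by
    rw [(AddCommute.all x y).addOrderOf_add_eq_mul_addOrderOf_of_coprime (by rwa [hx, hy]), hx, hy]
  have hcard : Nat.card G = p * q := by rw [Nat.card_eq_fintype_card, hG]
  have hcyc : IsAddCyclic G := isAddCyclic_of_addOrderOf_eq_card (x + y) (by rw [hxy, hcard])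
  exact ⟨((zmodAddCyclicAddEquiv hcyc).symm.trans
    (ZMod.ringEquivCongr hcard).toAddEquiv).trans (ZMod.chineseRemainder hco).toAddEquiv⟩
end

section

variable {G : Type*} [AddCommGroup G] [DecidableEq G]

theorem mem_nss {A : Finset G} {g : G} : g ∈ nss A ↔ ∃ B ⊆ A, B.Nonempty ∧ ∑ b ∈ B, b = g := by
  simp only [nss, mem_image, mem_erase, mem_powerset, id, nonempty_iff_ne_empty]
  constructor
  · rintro ⟨B, ⟨hne, hB⟩, h⟩
    exact ⟨B, hB, hne, h⟩
  · rintro ⟨B, hB, hne, h⟩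
    exact ⟨B, ⟨hne, hB⟩, h⟩

theorem cr_spec [Fintype G] {A : Finset G} (hA0 : 0 ∉ A) (hA : cr G ≤ #A) (g : G) : g ∈ nss A := by
  have hne : {ℓ : ℕ | 0 < ℓ ∧ ∀ A : Finset G, (0 : G) ∉ A → ℓ ≤ A.card →
      nss A = Finset.univ}.Nonempty :=
    ⟨Fintype.card G + 1, Nat.succ_pos _, fun A _ h => absurd (card_le_univ A) (by omega)⟩
  rw [(Nat.sInf_mem hne).2 A hA0 hA]
  exact mem_univ g

theorem nss_eq_closure {A : Finset G} (L : AddSubgroup G) (hAL : ∀ a ∈ A, a ∈ L)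
    (hL : ∀ g ∈ L, g ∈ nss A) : (nss A : Set G) = (AddSubgroup.closure (A : Set G) : Set G) := by
  ext g
  constructor
  · intro hg
    obtain ⟨B, hB, -, rfl⟩ := mem_nss.1 (mem_coe.1 hg)
    exact AddSubgroup.sum_mem _ fun b hb => AddSubgroup.subset_closure (hB hb)
  · intro hg
    exact mem_coe.2 (hL g ((AddSubgroup.closure_le L).2 (fun a ha => hAL a ha) hg))

theorem mem_nss_image {H : Type*} [AddCommGroup H] [DecidableEq H] (e : G ≃+ H) {A : Finset G}
    {g : G} (hg : g ∈ nss A) : e g ∈ nss (A.image e) := by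
  obtain ⟨B, hB, hne, rfl⟩ := mem_nss.1 hg
  refine mem_nss.2 ⟨B.image e, image_subset_image hB, hne.image _, ?_⟩
  rw [sum_image e.injective.injOn, map_sum]

theorem zero_notMem_image {H : Type*} [AddCommGroup H] [DecidableEq H] (e : G ≃+ H) {A : Finset G}
    (hA : 0 ∉ A) : 0 ∉ A.image e := by
  intro h
  obtain ⟨a, ha, h0⟩ := mem_image.1 h
  exact hA ((map_eq_zero_iff e e.injective).1 h0 ▸ ha)

end

theorem stmt3 {G : Type*} [AddCommGroup G] [Fintype G] [DecidableEq G]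
    {p q : ℕ} (hp : p.Prime) (hq : q.Prime) (hpodd : Odd p) (hqodd : Odd q)
    (hpq : 2 * p + 3 ≤ q) (hcardG : Fintype.card G = p * q)
    (A : Finset G) (hA0 : (0 : G) ∉ A) (hcard : A.card = cr G - 1) :
    ∃ A' : Finset G, A' ⊆ A ∧ A'.Nonempty ∧
      (nss A' : Set G) = (AddSubgroup.closure (A' : Set G) : Set G) := by
  have := Fact.mk hp
  have := Fact.mk hq
  have hp3 : 3 ≤ p := by
    have := hp.two_le
    rcases hpodd with ⟨k, rfl⟩
    omega
  obtain ⟨e⟩ := nonempty_addEquiv_zmod_prod (G := G) (p := p) (q := q) (by omega) hcardG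
  have hcr : p + q ≤ cr G + 2 := by
    obtain ⟨S, hS0, hS, hSR⟩ := exists_card_and_not_reach (p := p) (q := q) hp3 (by omega)
    by_contra hlt
    refine hSR fun g => mem_nss.1 ?_
    have hg := mem_nss_image e (cr_spec (zero_notMem_image e.symm hS0)
      (by rw [card_image_of_injective _ e.symm.injective]; omega) (e.symm g))
    simpa [image_image] using hg
  obtain ⟨A₁, hA₁, hA₁card⟩ := exists_subset_card_eq (show p + q - 3 ≤ #A by omega)
  obtain ⟨A', hA', hne, L, hAL, hL⟩ := exists_complete_of_card (A := A₁.image e) hpodd hqodd hpq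
    (zero_notMem_image e fun h => hA0 (hA₁ h))
    (by rw [card_image_of_injective _ e.injective]; omega)
  refine ⟨A'.image e.symm, ?_, hne.image _,
    nss_eq_closure (L.comap e.toAddMonoidHom) ?_ fun g hg => ?_⟩
  · intro a ha
    obtain ⟨b, hb, rfl⟩ := mem_image.1 ha
    obtain ⟨c, hc, rfl⟩ := mem_image.1 (hA' hb)
    simpa using hA₁ hc
  · intro a ha
    obtain ⟨b, hb, rfl⟩ := mem_image.1 ha
    simpa using hAL b hb
  · simpa using mem_nss_image e.symm (mem_nss.2 (hL (e g) hg))
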